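/- arXiv:2205.04420 — 5 statements merged into one kernel-verified Lean document; each statement's English description precedes it below -/
import Mathlib

section
/- Let G be a sparse graph and let (A,C,B) be a separation of G with A ≠ ∅ and B ≠ ∅. Suppose there exist vertices v_1, …, v_k ∈ C such that C ⊆ N[v_1] ∪ ⋯ ∪ N[v_k]. Let D_1 be a connected component of A and D_2 a connected component of B. Then there exist cliques X_1, …, X_k ⊆ C of G such that every path from a vertex of D_1 to a vertex of D_2 meets X_1 ∪ ⋯ ∪ X_k. In particular, if G admits a star cutset, then G admits a clique cutset. -/
open SimpleGraph Set List

namespace Paper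

variable {V : Type} {W : Type}

/-- The closed neighborhood `N[v]` of a vertex. -/
def closedNbhd (G : SimpleGraph V) (v : V) : Set V := insert v (G.neighborSet v)

/-- The degree of a vertex (as the number of its neighbors). -/
noncomputable def deg (G : SimpleGraph V) (v : V) : ℕ := (G.neighborSet v).ncard

/-- `G` contains `H` as an induced subgraph, i.e. some induced subgraph of `G` is
isomorphic to `H`. -/
def ContainsInduced (G : SimpleGraph V) (H : SimpleGraph W) : Prop :=
  ∃ s : Set V, Nonempty (H ≃g G.induce s)

/-- `(A, C, B)` is a separation of `G`. -/
def IsSeparation (G : SimpleGraph V) (A C B : Set V) : Prop :=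
  A ∪ C ∪ B = Set.univ ∧ Disjoint A C ∧ Disjoint A B ∧ Disjoint C B ∧
    ∀ a ∈ A, ∀ b ∈ B, ¬G.Adj a b

/-- `G` admits a star cutset. -/
def HasStarCutset (G : SimpleGraph V) : Prop :=
  ∃ A C B : Set V, IsSeparation G A C B ∧ A.Nonempty ∧ B.Nonempty ∧
    ∃ v ∈ C, C ⊆ closedNbhd G v

/-- `G` admits a clique cutset. -/
def HasCliqueCutset (G : SimpleGraph V) : Prop :=
  ∃ A C B : Set V, IsSeparation G A C B ∧ A.Nonempty ∧ B.Nonempty ∧ G.IsClique C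

/-- `D` is a connected component of `G \ X`: a maximal connected subset of `Xᶜ`. -/
def IsComponentOf (G : SimpleGraph V) (X : Set V) (D : Set V) : Prop :=
  D.Nonempty ∧ D ⊆ Xᶜ ∧ (G.induce D).Connected ∧
    ∀ D' : Set V, D ⊆ D' → D' ⊆ Xᶜ → (G.induce D').Connected → D' = D

/-- An induced path in `G` ("path" in the paper always means induced path). -/
def IsIPath (G : SimpleGraph V) {u v : V} (P : G.Walk u v) : Prop :=
  P.IsPath ∧ P.toSubgraph.IsInduced

/-- A hole: an induced cycle of length at least four. -/
def IsHole (G : SimpleGraph V) {v : V} (c : G.Walk v v) : Prop :=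
  c.IsCycle ∧ 4 ≤ c.length ∧ c.toSubgraph.IsInduced

/-- `G` is sparse: for every hole and every vertex not in it, there is an edge `ab` of the
hole containing all neighbors of the vertex in the hole. -/
def Sparse (G : SimpleGraph V) : Prop :=
  ∀ (v : V) (c : G.Walk v v), IsHole G c → ∀ x, x ∉ c.support →
    ∃ a b, c.toSubgraph.Adj a b ∧ ∀ y ∈ c.support, G.Adj x y → y = a ∨ y = b

/-- `G` contains a pyramid (necessarily as an induced subgraph). -/
def ContainsPyramid (G : SimpleGraph V) : Prop :=
  ∃ (a b₁ b₂ b₃ : V) (P₁ : G.Walk a b₁) (P₂ : G.Walk a b₂) (P₃ : G.Walk a b₃),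
    G.Adj b₁ b₂ ∧ G.Adj b₂ b₃ ∧ G.Adj b₁ b₃ ∧
    IsIPath G P₁ ∧ IsIPath G P₂ ∧ IsIPath G P₃ ∧
    1 ≤ P₁.length ∧ 1 ≤ P₂.length ∧ 1 ≤ P₃.length ∧
    ¬(P₁.length = 1 ∧ P₂.length = 1) ∧ ¬(P₁.length = 1 ∧ P₃.length = 1) ∧
    ¬(P₂.length = 1 ∧ P₃.length = 1) ∧
    (∀ p ∈ P₁.support, p ≠ a → ∀ q ∈ P₂.support, q ≠ a →
      p ≠ q ∧ (G.Adj p q → p = b₁ ∧ q = b₂)) ∧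
    (∀ p ∈ P₁.support, p ≠ a → ∀ q ∈ P₃.support, q ≠ a →
      p ≠ q ∧ (G.Adj p q → p = b₁ ∧ q = b₃)) ∧
    (∀ p ∈ P₂.support, p ≠ a → ∀ q ∈ P₃.support, q ≠ a →
      p ≠ q ∧ (G.Adj p q → p = b₂ ∧ q = b₃))

/-- `G` contains a prism (necessarily as an induced subgraph). -/
def ContainsPrism (G : SimpleGraph V) : Prop :=
  ∃ (a₁ a₂ a₃ b₁ b₂ b₃ : V) (P₁ : G.Walk a₁ b₁) (P₂ : G.Walk a₂ b₂) (P₃ : G.Walk a₃ b₃),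
    G.Adj a₁ a₂ ∧ G.Adj a₂ a₃ ∧ G.Adj a₁ a₃ ∧
    G.Adj b₁ b₂ ∧ G.Adj b₂ b₃ ∧ G.Adj b₁ b₃ ∧
    IsIPath G P₁ ∧ IsIPath G P₂ ∧ IsIPath G P₃ ∧
    1 ≤ P₁.length ∧ 1 ≤ P₂.length ∧ 1 ≤ P₃.length ∧
    (∀ p ∈ P₁.support, ∀ q ∈ P₂.support,
      p ≠ q ∧ (G.Adj p q → (p = a₁ ∧ q = a₂) ∨ (p = b₁ ∧ q = b₂))) ∧
    (∀ p ∈ P₁.support, ∀ q ∈ P₃.support,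
      p ≠ q ∧ (G.Adj p q → (p = a₁ ∧ q = a₃) ∨ (p = b₁ ∧ q = b₃))) ∧
    (∀ p ∈ P₂.support, ∀ q ∈ P₃.support,
      p ≠ q ∧ (G.Adj p q → (p = a₂ ∧ q = a₃) ∨ (p = b₂ ∧ q = b₃)))

/-- `G` is very sparse: sparse, pyramid-free and prism-free. -/
def VerySparse (G : SimpleGraph V) : Prop :=
  Sparse G ∧ ¬ContainsPyramid G ∧ ¬ContainsPrism G

/-- `G ∈ 𝓕_t`: `G` is very sparse with no clique of size at least `t+1`. -/
def MemF (t : ℕ) (G : SimpleGraph V) : Prop :=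
  VerySparse G ∧ ∀ s : Set V, G.IsClique s → s.ncard ≤ t

/-- `G` has a tree decomposition of width at most `k`. -/
def HasTreewidthAtMost (G : SimpleGraph V) (k : ℕ) : Prop :=
  ∃ (ι : Type) (T : SimpleGraph ι) (χ : ι → Finset V),
    T.IsTree ∧
    (∀ v : V, ∃ t, v ∈ χ t) ∧
    (∀ u v : V, G.Adj u v → ∃ t, u ∈ χ t ∧ v ∈ χ t) ∧
    (∀ v : V, (T.induce {t | v ∈ χ t}).Connected) ∧
    ∀ t, (χ t).card ≤ k + 1

/-- The `n`-by-`n` wall, as a brick wall graph: `n` rows of `2n` vertices each,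
with horizontal path edges in each row, and vertical edges between consecutive
rows placed alternately. -/
def Wall (n : ℕ) : SimpleGraph (Fin n × Fin (2 * n)) :=
  SimpleGraph.fromRel (fun a b =>
    (a.1 = b.1 ∧ a.2.val + 1 = b.2.val) ∨
    (a.2 = b.2 ∧ a.1.val + 1 = b.1.val ∧ (a.1.val + a.2.val) % 2 = 0))

/-- The graph obtained from `G` by subdividing the edge `uv` once (the new vertex
is `none`). -/
def subdivideEdge (G : SimpleGraph V) (u v : V) : SimpleGraph (Option V) :=
  SimpleGraph.fromRel (fun a b =>
    (∃ x y : V, a = some x ∧ b = some y ∧ G.Adj x y ∧ ¬(x = u ∧ y = v) ∧ ¬(x = v ∧ y = u)) ∨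
    (a = none ∧ (b = some u ∨ b = some v)))

/-- `IsSubdivision G H`: `G` is (isomorphic to) a graph obtained from `H` by repeatedly
subdividing edges. -/
inductive IsSubdivision : {α : Type} → SimpleGraph α → {β : Type} → SimpleGraph β → Prop where
  | base {α β : Type} {G : SimpleGraph α} {H : SimpleGraph β} :
      Nonempty (G ≃g H) → IsSubdivision G H
  | step {α β : Type} {G : SimpleGraph α} {H : SimpleGraph β} (u v : β) :
      H.Adj u v → IsSubdivision G (subdivideEdge H u v) → IsSubdivision G H

/-- `G` contains a subdivision of the `t`-by-`t` wall as an induced subgraph. -/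
def ContainsWallSubdiv (G : SimpleGraph V) (t : ℕ) : Prop :=
  ∃ (α : Type) (S : SimpleGraph α), IsSubdivision S (Wall t) ∧ ContainsInduced G S

/-- `G` contains the line graph of a subdivision of the `t`-by-`t` wall as an induced
subgraph. -/
def ContainsLineWallSubdiv (G : SimpleGraph V) (t : ℕ) : Prop :=
  ∃ (α : Type) (S : SimpleGraph α), IsSubdivision S (Wall t) ∧
    ContainsInduced G S.lineGraph

/-- `G` is `𝓣₁`-free: no vertex has two or more neighbors in a hole not containing it. -/
def T1Free (G : SimpleGraph V) : Prop :=
  ∀ (v : V) (c : G.Walk v v), IsHole G c → ∀ x, x ∉ c.support →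
    ∀ y z, y ∈ c.support → z ∈ c.support → G.Adj x y → G.Adj x z → y = z

/-- `G` is `𝓣₂`-free: no vertex has two non-adjacent neighbors in a hole not containing
it, and `G` is pyramid-free and prism-free. -/
def T2Free (G : SimpleGraph V) : Prop :=
  (∀ (v : V) (c : G.Walk v v), IsHole G c → ∀ x, x ∉ c.support →
    ∀ y z, y ∈ c.support → z ∈ c.support → G.Adj x y → G.Adj x z → y ≠ z → G.Adj y z) ∧
  ¬ContainsPyramid G ∧ ¬ContainsPrism G

/-- The weight `w(X)` of a set of vertices. -/
noncomputable def setW (w : V → ℝ) (X : Set V) : ℝ := ∑ᶠ x ∈ X, w x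

/-- `w` is a weight function on `G`: values in `[0,1]` with total weight `1`. -/
def IsWeightFn (w : V → ℝ) : Prop :=
  (∀ v, 0 ≤ w v ∧ w v ≤ 1) ∧ setW w Set.univ = 1

/-- `X` is a `(w, c)`-balanced separator. -/
def IsBalSep (G : SimpleGraph V) (w : V → ℝ) (c : ℝ) (X : Set V) : Prop :=
  ∀ D, IsComponentOf G X D → setW w D ≤ c

/-- `(G, w)` is `d`-unbalanced: `w` is a weight function and there is no
`(w, 1/2)`-balanced separator of size at most `d`. -/
def Unbalanced (G : SimpleGraph V) (w : V → ℝ) (d : ℕ) : Prop :=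
  IsWeightFn w ∧ ∀ X : Set V, X.ncard ≤ d → ¬IsBalSep G w (1 / 2 : ℝ) X

/-- `B = B(K₁,K₂)` is the (unique) component of `G ∖ (K₁ ∪ K₂)` of weight more
than `1/2`.  Then `A(K₁,K₂) = (B ∪ K₁ ∪ K₂)ᶜ` and `S(K₁,K₂) = (A, K₁ ∪ K₂, B)` is the
canonical two-clique-separation for `{K₁, K₂}`. -/
def IsCanonicalB (G : SimpleGraph V) (w : V → ℝ) (K₁ K₂ B : Set V) : Prop :=
  IsComponentOf G (K₁ ∪ K₂) B ∧ (1 / 2 : ℝ) < setW w B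

/-- The open neighborhood `N(D)` of a set of vertices. -/
def nbhdOfSet (G : SimpleGraph V) (D : Set V) : Set V :=
  {v | v ∉ D ∧ ∃ d ∈ D, G.Adj v d}

/-- The canonical two-clique-separation `S(K₁,K₂)` (with big side `B`) is proper. -/
def ProperPair (G : SimpleGraph V) (w : V → ℝ) (K₁ K₂ B : Set V) : Prop :=
  IsCanonicalB G w K₁ K₂ B ∧
  (∃ D, IsComponentOf G (K₁ ∪ K₂) D ∧ D ⊆ (B ∪ K₁ ∪ K₂)ᶜ ∧
    K₁ ∪ K₂ ⊆ nbhdOfSet G D) ∧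
  (K₁.ncard = 1 → K₂.ncard = 1 →
    ¬∃ (x y : V) (P : G.Walk x y), K₁ = {x} ∧ K₂ = {y} ∧ IsIPath G P ∧
      {v | v ∈ P.support} = (B ∪ K₁ ∪ K₂)ᶜ ∪ K₁ ∪ K₂)

/-- The canonical two-clique-separation `S(K₁,K₂)` (with big side `B`) is active,
where `K` bounds the size of the cliques considered. -/
def ActivePair (G : SimpleGraph V) (w : V → ℝ) (K : ℕ) (K₁ K₂ B : Set V) : Prop :=
  ProperPair G w K₁ K₂ B ∧
  ∀ K₁' K₂' B' : Set V, G.IsClique K₁' → G.IsClique K₂' →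
    K₁'.ncard ≤ K → K₂'.ncard ≤ K → ProperPair G w K₁' K₂' B' →
    K₁ ∪ K₂ ≠ K₁' ∪ K₂' →
      ¬(B' ∪ K₁' ∪ K₂' ⊂ B ∪ K₁ ∪ K₂) ∧
      (B' ∪ K₁' ∪ K₂' = B ∪ K₁ ∪ K₂ → B' ⊂ B)

/-- The interiors of two paths from `a` to `b` are disjoint and anticomplete. -/
def IntDisjAnti (G : SimpleGraph V) {a b : V} (P Q : G.Walk a b) : Prop :=
  ∀ x ∈ P.support, x ≠ a → x ≠ b → ∀ y ∈ Q.support, y ≠ a → y ≠ b → x ≠ y ∧ ¬G.Adj x y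

/-- `Q₁, Q₂, Q₃` form a theta (as an induced subgraph of `G`) with ends `a, b`. -/
def ThetaCfg (G : SimpleGraph V) {a b : V} (Q₁ Q₂ Q₃ : G.Walk a b) : Prop :=
  ¬G.Adj a b ∧
  IsIPath G Q₁ ∧ IsIPath G Q₂ ∧ IsIPath G Q₃ ∧
  2 ≤ Q₁.length ∧ 2 ≤ Q₂.length ∧ 2 ≤ Q₃.length ∧
  IntDisjAnti G Q₁ Q₂ ∧ IntDisjAnti G Q₁ Q₃ ∧ IntDisjAnti G Q₂ Q₃

/-- There is a theta through the seagull `a-v-u` in `G`: a theta one of whose ends is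
`a` or `u` and which contains the seagull. -/
def ThetaThroughSeagull (G : SimpleGraph V) (a v u : V) : Prop :=
  (∃ (b : V) (Q₁ Q₂ Q₃ : G.Walk a b), ThetaCfg G Q₁ Q₂ Q₃ ∧ [a, v, u] <+: Q₁.support) ∨
  (∃ (b : V) (Q₁ Q₂ Q₃ : G.Walk u b), ThetaCfg G Q₁ Q₂ Q₃ ∧ [u, v, a] <+: Q₁.support)

/-- `a-v-u` is a heavy seagull in `G`: an induced three-vertex path whose ends both
have degree at least three. -/
def HeavySeagull (G : SimpleGraph V) (a v u : V) : Prop :=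
  a ≠ u ∧ G.Adj a v ∧ G.Adj v u ∧ ¬G.Adj a u ∧ 3 ≤ deg G a ∧ 3 ≤ deg G u

end Paper

namespace Paper

/-- Connectedness of a set by walks inside it. -/
def Conn {V : Type} (G : SimpleGraph V) (D : Set V) : Prop :=
  ∀ d ∈ D, ∀ e ∈ D, ∃ p : G.Walk d e, ∀ z ∈ p.support, z ∈ D

/-- Vertices reachable from `y` by walks inside `T`. -/
def Rch {V : Type} (G : SimpleGraph V) (T : Set V) (y : V) : Set V :=
  {z | ∃ p : G.Walk y z, ∀ w ∈ p.support, w ∈ T}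

theorem rch_conn {V : Type} (G : SimpleGraph V) (T : Set V) (y : V) : Conn G (Rch G T y) := by
  classical
  have key : ∀ z (p : G.Walk y z), (∀ w ∈ p.support, w ∈ T) → ∀ w ∈ p.support, w ∈ Rch G T y := by
    intro z p hp w hw
    exact ⟨p.takeUntil w hw, fun u hu => hp u (p.support_takeUntil_subset_support hw hu)⟩
  rintro d ⟨p, hp⟩ e ⟨q, hq⟩
  refine ⟨p.reverse.append q, fun z hz => ?_⟩
  rw [Walk.mem_support_append_iff] at hz
  rcases hz with hz | hz
  · exact key _ p hp z (by simpa using hz)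
  · exact key _ q hq z hz

theorem rch_closed {V : Type} {G : SimpleGraph V} {T : Set V} {y z w : V}
    (hz : z ∈ Rch G T y) (h : G.Adj z w) (hw : w ∈ T) : w ∈ Rch G T y := by
  obtain ⟨p, hp⟩ := hz
  refine ⟨p.concat h, fun u hu => ?_⟩
  simp [Walk.support_concat] at hu
  rcases hu with hu | rfl
  · exact hp u hu
  · exact hw

theorem rch_sub {V : Type} {G : SimpleGraph V} {T : Set V} {y z : V}
    (hz : z ∈ Rch G T y) : z ∈ T := by
  obtain ⟨p, hp⟩ := hz
  exact hp _ p.end_mem_support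

theorem conn_of_induce {V : Type} {G : SimpleGraph V} {D : Set V}
    (h : (G.induce D).Connected) : Conn G D := by
  intro d hd e he
  obtain ⟨p⟩ := h.preconnected ⟨d, hd⟩ ⟨e, he⟩
  have key : ∀ (a b : D) (p : (G.induce D).Walk a b),
      ∃ q : G.Walk a.1 b.1, ∀ z ∈ q.support, z ∈ D := by
    intro a b p
    induction p with
    | nil => exact ⟨Walk.nil, by simp⟩
    | cons h p ih =>
      obtain ⟨q, hq⟩ := ih
      refine ⟨Walk.cons (induce_adj.1 h) q, ?_⟩
      intro z hz
      rw [Walk.support_cons, List.mem_cons] at hz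
      rcases hz with rfl | hz
      · exact Subtype.property _
      · exact hq z hz
  exact key _ _ p

/-- A shortest walk inside `T` is an induced path. -/
theorem exists_ipath {V : Type} {G : SimpleGraph V} {T : Set V} {x y : V}
    (h : ∃ p : G.Walk x y, ∀ z ∈ p.support, z ∈ T) :
    ∃ p : G.Walk x y, IsIPath G p ∧ ∀ z ∈ p.support, z ∈ T := by
  classical
  have hex : ∃ n, ∃ p : G.Walk x y, p.length = n ∧ ∀ z ∈ p.support, z ∈ T := by
    obtain ⟨p, hp⟩ := h
    exact ⟨_, p, rfl, hp⟩
  obtain ⟨q, hql, hqT⟩ := Nat.find_spec hex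
  have hmin : ∀ r : G.Walk x y, (∀ z ∈ r.support, z ∈ T) → q.length ≤ r.length := by
    intro r hr
    rw [hql]
    exact Nat.find_min' hex ⟨r, rfl, hr⟩
  set p := q.bypass with hpdef
  have hpT : ∀ z ∈ p.support, z ∈ T := fun z hz => hqT z (q.support_bypass_subset_support hz)
  have hpl : p.length ≤ q.length := q.length_bypass_le_length
  have key : ∀ i j, i < j → j ≤ p.length → G.Adj (p.getVert i) (p.getVert j) →
      p.toSubgraph.Adj (p.getVert i) (p.getVert j) := by
    intro i j hij hj hadj
    have hr := hmin ((p.take i).append (Walk.cons hadj (p.drop j))) (by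
      intro z hz
      rw [Walk.mem_support_append_iff, Walk.support_cons, List.mem_cons] at hz
      rcases hz with hz | rfl | hz
      · rw [Walk.support_take] at hz
        exact hpT z (List.mem_of_mem_take hz)
      · exact hpT _ (p.getVert_mem_support i)
      · rw [Walk.drop_support_eq_support_drop_min] at hz
        exact hpT z (List.mem_of_mem_drop hz))
    rw [Walk.length_append, Walk.length_cons, Walk.take_length, Walk.drop_length] at hr
    have : j = i + 1 := by omega
    subst this
    exact p.toSubgraph_adj_getVert (by omega)
  refine ⟨p, ⟨q.bypass_isPath, ?_⟩, hpT⟩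
  intro u hu w hw hadj
  rw [Walk.mem_verts_toSubgraph, Walk.mem_support_iff_exists_getVert] at hu hw
  obtain ⟨i, rfl, hi⟩ := hu
  obtain ⟨j, rfl, hj⟩ := hw
  rcases lt_trichotomy i j with hij | rfl | hij
  · exact key i j hij hj hadj
  · exact absurd hadj (G.irrefl)
  · exact (key j i hij hi hadj.symm).symm

theorem exists_ipath_through {V : Type} {G : SimpleGraph V} {D : Set V} {x y d e : V}
    (hD : Conn G D) (hd : d ∈ D) (he : e ∈ D) (hx : G.Adj x d) (hy : G.Adj e y) :
    ∃ p : G.Walk x y, IsIPath G p ∧ ∀ z ∈ p.support, z = x ∨ z = y ∨ z ∈ D := by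
  obtain ⟨p, hp⟩ := hD d hd e he
  refine exists_ipath (T := {z | z = x ∨ z = y ∨ z ∈ D}) ⟨Walk.cons hx (p.concat hy), ?_⟩
  intro z hz
  simp only [Walk.support_cons, Walk.support_concat, List.mem_cons] at hz
  simp only [Set.mem_setOf_eq]
  rcases hz with rfl | hz
  · simp
  · simp at hz
    rcases hz with hz | rfl
    · exact Or.inr (Or.inr (hp z hz))
    · simp

/-- The key hole argument. -/
theorem adj_of_common {V : Type} {G : SimpleGraph V} (hG : Sparse G) {D E : Set V}
    (hD : Conn G D) (hE : Conn G E) (hDE : ∀ z ∈ D, z ∉ E)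
    (hanti : ∀ z ∈ D, ∀ w ∈ E, ¬ G.Adj z w)
    {x y v d d' e e' : V} (hxy : x ≠ y)
    (hxD : x ∉ D) (hxE : x ∉ E) (hyD : y ∉ D) (hyE : y ∉ E) (hvD : v ∉ D) (hvE : v ∉ E)
    (hvx : G.Adj v x) (hvy : G.Adj v y)
    (hd : d ∈ D) (hd' : d' ∈ D) (he : e ∈ E) (he' : e' ∈ E)
    (hxd : G.Adj x d) (hyd : G.Adj d' y) (hxe : G.Adj x e) (hye : G.Adj e' y) : G.Adj x y := by
  by_contra hnadj
  obtain ⟨p, ⟨hp, hpi⟩, hps⟩ := exists_ipath_through hD hd hd' hxd hyd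
  obtain ⟨q, ⟨hq, hqi⟩, hqs⟩ := exists_ipath_through hE he he' hxe hye
  have hlen : ∀ r : G.Walk x y, 2 ≤ r.length := by
    intro r
    by_contra hlt
    have : r.length = 0 ∨ r.length = 1 := by omega
    rcases this with h | h
    · exact hxy (Walk.eq_of_length_eq_zero h)
    · exact hnadj (Walk.adj_of_length_eq_one h)
  have hpl := hlen p
  have hql := hlen q
  have hcyc : (p.append q.reverse).IsCycle := by
    refine hp.isCycle_append hq.reverse ?_ (Or.inl (by omega))
    have h1 : x ∉ p.support.tail := by
      have := hp.support_nodup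
      rw [p.support_eq_cons] at this
      exact (List.nodup_cons.mp this).1
    have h2 : y ∉ q.reverse.support.tail := by
      have := hq.reverse.support_nodup
      rw [q.reverse.support_eq_cons] at this
      exact (List.nodup_cons.mp this).1
    intro z hz hz'
    have hzx : z ≠ x := by rintro rfl; exact h1 hz
    have hzy : z ≠ y := by rintro rfl; exact h2 hz'
    have a := hps z (List.mem_of_mem_tail hz)
    have b := hqs z (by simpa using List.mem_of_mem_tail hz')
    have := hDE z
    tauto
  have hsup : ∀ z, z ∈ (p.append q.reverse).support ↔ z ∈ p.support ∨ z ∈ q.support := by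
    intro z
    rw [Walk.mem_support_append_iff]; simp
  have hcross : ∀ a ∈ p.support, ∀ b ∈ q.support, G.Adj a b →
      (p.toSubgraph ⊔ q.toSubgraph).Adj a b := by
    intro a ha b hb hab
    rw [Subgraph.sup_adj]
    by_cases haq : a ∈ q.support
    · exact Or.inr (hqi (by simpa using haq) (by simpa using hb) hab)
    by_cases hbp : b ∈ p.support
    · exact Or.inl (hpi (by simpa using ha) (by simpa using hbp) hab)
    exfalso
    rcases hps a ha with rfl | rfl | ha'
    · exact haq q.start_mem_support
    · exact haq q.end_mem_support
    rcases hqs b hb with rfl | rfl | hb'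
    · exact hbp p.start_mem_support
    · exact hbp p.end_mem_support
    exact hanti a ha' b hb' hab
  have hhole : IsHole G (p.append q.reverse) := by
    refine ⟨hcyc, ?_, ?_⟩
    · rw [Walk.length_append, Walk.length_reverse]; omega
    · intro a ha b hb hab
      rw [Walk.mem_verts_toSubgraph, hsup] at ha hb
      rw [Walk.toSubgraph_append, Walk.toSubgraph_reverse]
      rcases ha with ha | ha <;> rcases hb with hb | hb
      · exact Or.inl (hpi (by simpa using ha) (by simpa using hb) hab)
      · exact hcross a ha b hb hab
      · exact (hcross b hb a ha hab.symm).symm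
      · exact Or.inr (hqi (by simpa using ha) (by simpa using hb) hab)
  have hv : v ∉ (p.append q.reverse).support := by
    rw [hsup]
    rintro (h | h)
    · have := hps v h
      have := hvx.ne
      have := hvy.ne
      tauto
    · have := hqs v h
      have := hvx.ne
      have := hvy.ne
      tauto
  obtain ⟨a, b, hab, hall⟩ := hG x _ hhole v hv
  have hab' : G.Adj a b := hab.adj_sub
  have hx := hall x (by rw [hsup]; exact Or.inl p.start_mem_support) hvx
  have hy := hall y (by rw [hsup]; exact Or.inl p.end_mem_support) hvy
  rcases hx with rfl | rfl <;> rcases hy with rfl | rfl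
  · exact hxy rfl
  · exact hnadj hab'
  · exact hnadj hab'.symm
  · exact hxy rfl

theorem core {V : Type} {G : SimpleGraph V} (hG : Sparse G) (C D₁ D₂ : Set V)
    (h₁ : Conn G D₁) (h₂ : Conn G D₂) (hne : D₂.Nonempty)
    (h₁C : ∀ z ∈ D₁, z ∉ C) (h₂C : ∀ z ∈ D₂, z ∉ C) (h₁₂ : ∀ z ∈ D₁, z ∉ D₂)
    (hN : ∀ d ∈ D₁, ∀ z, z ∉ D₁ → G.Adj d z → z ∈ C)
    (k : ℕ) (vf : Fin k → V) (hvC : ∀ i, vf i ∈ C)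
    (hcov : C ⊆ ⋃ i, closedNbhd G (vf i)) :
    ∃ X : Fin k → Set V, (∀ i, G.IsClique (X i) ∧ X i ⊆ C) ∧
      ∀ x y : V, x ∈ D₁ → y ∈ D₂ → ∀ P : G.Walk x y, ∃ z ∈ P.support, ∃ i, z ∈ X i := by
  obtain ⟨y₀, hy₀⟩ := hne
  set T : Set V := {z | (∀ i, z ≠ vf i) ∧ ¬ (z ∉ D₁ ∧ ∃ d ∈ D₁, G.Adj d z)} with hT
  have hD₂T : ∀ z ∈ D₂, z ∈ T := by
    intro z hz
    refine ⟨fun i h => h₂C z hz (h ▸ hvC i), ?_⟩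
    rintro ⟨h, d, hd, hdz⟩
    exact h₂C z hz (hN d hd z h hdz)
  set E := Rch G T y₀ with hE
  have hD₂E : ∀ z ∈ D₂, z ∈ E := by
    intro z hz
    obtain ⟨p, hp⟩ := h₂ y₀ hy₀ z hz
    exact ⟨p, fun w hw => hD₂T w (hp w hw)⟩
  have hDE : ∀ z ∈ D₁, z ∉ E := by
    rintro z hz ⟨p, hp⟩
    obtain ⟨d, hd, hf, hs⟩ := p.exists_boundary_dart (D₁ᶜ) (fun h => h₁₂ _ h hy₀) (by simpa using hz)
    have hs' : d.snd ∈ D₁ := by simpa using hs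
    exact (hp _ (p.dart_fst_mem_support_of_mem_darts hd)).2 ⟨hf, _, hs', d.adj.symm⟩
  have hanti : ∀ z ∈ D₁, ∀ w ∈ E, ¬ G.Adj z w := by
    intro z hz w hw h
    exact (rch_sub hw).2 ⟨fun h => hDE w h hw, z, hz, h⟩
  set K : Set V := {z | z ∉ D₁ ∧ (∃ d ∈ D₁, G.Adj d z) ∧ (∀ i, z ≠ vf i) ∧ ∃ e ∈ E, G.Adj z e} with hK
  have hKC : ∀ z ∈ K, z ∈ C := by
    rintro z ⟨h, ⟨d, hd, hdz⟩, -⟩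
    exact hN d hd z h hdz
  have hKE : ∀ z ∈ K, z ∉ E := by
    rintro z ⟨h, h', -⟩ hz
    exact (rch_sub hz).2 ⟨h, h'⟩
  refine ⟨fun i => insert (vf i) (K ∩ {z | G.Adj (vf i) z}), fun i => ⟨?_, ?_⟩, ?_⟩
  · have hvE : vf i ∉ E := fun h => (rch_sub h).1 i rfl
    rw [SimpleGraph.isClique_insert]
    refine ⟨?_, fun b hb _ => hb.2⟩
    rintro x ⟨hx, hvx⟩ y ⟨hy, hvy⟩ hxy
    have hxE := hKE x hx
    have hyE := hKE y hy
    obtain ⟨hxD, ⟨d, hd, hdx⟩, -, e, he, hxe⟩ := hx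
    obtain ⟨hyD, ⟨d', hd', hdy⟩, -, e', he', hye⟩ := hy
    exact adj_of_common hG h₁ (rch_conn G T y₀) hDE hanti hxy hxD hxE hyD hyE
      (fun h => h₁C _ h (hvC i)) hvE hvx hvy hd hd' he he' hdx.symm hdy hxe hye.symm
  · intro z hz
    rcases hz with rfl | hz
    · exact hvC i
    · exact hKC z hz.1
  · intro x y hx hy P
    obtain ⟨d, hd, hf, hs⟩ := P.exists_boundary_dart (Eᶜ) (hDE x hx) (by simpa using hD₂E y hy)
    have hs' : d.snd ∈ E := by simpa using hs
    refine ⟨d.fst, P.dart_fst_mem_support_of_mem_darts hd, ?_⟩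
    by_cases hv : ∃ i, d.fst = vf i
    · obtain ⟨i, hi⟩ := hv
      exact ⟨i, Or.inl hi⟩
    push Not at hv
    have hnT : d.fst ∉ T := fun h => hf (rch_closed hs' d.adj.symm h)
    have hB : d.fst ∉ D₁ ∧ ∃ e ∈ D₁, G.Adj e d.fst := by
      by_contra hcon
      exact hnT ⟨hv, hcon⟩
    have hdK : d.fst ∈ K := ⟨hB.1, hB.2, hv, _, hs', d.adj⟩
    obtain ⟨i, hi⟩ := Set.mem_iUnion.mp (hcov (hKC _ hdK))
    rcases hi with hi | hi
    · exact absurd hi (hv i)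
    · exact ⟨i, Or.inr ⟨hdK, hi⟩⟩

theorem star_to_clique {V : Type} {G : SimpleGraph V} (hG : Sparse G) (h : HasStarCutset G) :
    HasCliqueCutset G := by
  obtain ⟨A, C, B, ⟨hU, hAC, hAB, hCB, hnad⟩, ⟨a, ha⟩, ⟨b, hb⟩, v, hvC, hCv⟩ := h
  have haA : a ∈ Rch G A a := ⟨Walk.nil, by simpa using ha⟩
  obtain ⟨X, hX, hP⟩ := core hG C (Rch G A a) {b} (rch_conn G A a)
    (by rintro d rfl e rfl; exact ⟨Walk.nil, by simp⟩) ⟨b, rfl⟩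
    (fun z hz => Set.disjoint_left.mp hAC (rch_sub hz))
    (by rintro z rfl h; exact Set.disjoint_left.mp hCB h hb)
    (by rintro z hz rfl; exact Set.disjoint_left.mp hAB (rch_sub hz) hb)
    (by
      intro d hd z hz hdz
      have : z ∈ A ∪ C ∪ B := hU ▸ Set.mem_univ z
      rcases this with (h | h) | h
      · exact absurd (rch_closed hd hdz h) hz
      · exact h
      · exact absurd hdz (hnad d (rch_sub hd) z h))
    1 (fun _ => v) (fun _ => hvC) (fun z hz => Set.mem_iUnion.mpr ⟨0, hCv hz⟩)
  have haX : a ∉ X 0 := fun h => Set.disjoint_left.mp hAC ha ((hX 0).2 h)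
  have hbX : b ∉ X 0 := fun h => Set.disjoint_left.mp hCB ((hX 0).2 h) hb
  refine ⟨Rch G (X 0)ᶜ a, X 0, (Rch G (X 0)ᶜ a ∪ X 0)ᶜ, ⟨?_, ?_, ?_, ?_, ?_⟩,
    ⟨a, Walk.nil, by simpa using haX⟩, ⟨b, ?_⟩, (hX 0).1⟩
  · exact Set.union_compl_self _
  · rw [Set.disjoint_left]; exact fun z hz => rch_sub hz
  · rw [Set.disjoint_left]; exact fun z hz h => h (Or.inl hz)
  · rw [Set.disjoint_left]; exact fun z hz h => h (Or.inr hz)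
  · intro z hz w hw hzw
    exact hw (Or.inl (rch_closed hz hzw (fun h => hw (Or.inr h))))
  · rintro (⟨p, hp⟩ | h)
    · obtain ⟨z, hz, i, hi⟩ := hP a b haA rfl p
      rw [Subsingleton.elim i 0] at hi
      exact hp z hz hi
    · exact hbX h

/-- Lemma `startoclique`. -/
theorem statement5 {V : Type} [Fintype V] (G : SimpleGraph V) (hG : Sparse G)
    (A C B : Set V) (hsep : IsSeparation G A C B) (hA : A.Nonempty) (hB : B.Nonempty)
    (k : ℕ) (vf : Fin k → V) (hvC : ∀ i, vf i ∈ C)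
    (hcov : C ⊆ ⋃ i, closedNbhd G (vf i))
    (D₁ D₂ : Set V) (hD₁ : IsComponentOf G Aᶜ D₁) (hD₂ : IsComponentOf G Bᶜ D₂) :
    (∃ X : Fin k → Set V, (∀ i, G.IsClique (X i) ∧ X i ⊆ C) ∧
      ∀ x y : V, x ∈ D₁ → y ∈ D₂ → ∀ P : G.Walk x y, IsIPath G P →
        ∃ z ∈ P.support, ∃ i, z ∈ X i) ∧
    (HasStarCutset G → HasCliqueCutset G) := by
  refine ⟨?_, star_to_clique hG⟩
  obtain ⟨hU, hAC, hAB, hCB, hnad⟩ := hsep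
  obtain ⟨-, hs₁, hc₁, hm₁⟩ := hD₁
  obtain ⟨hn₂, hs₂, hc₂, -⟩ := hD₂
  rw [compl_compl] at hs₁ hs₂
  obtain ⟨X, hX, hP⟩ := core hG C D₁ D₂ (conn_of_induce hc₁) (conn_of_induce hc₂) hn₂
    (fun z hz => Set.disjoint_left.mp hAC (hs₁ hz))
    (fun z hz h => Set.disjoint_left.mp hCB h (hs₂ hz))
    (fun z hz h => Set.disjoint_left.mp hAB (hs₁ hz) (hs₂ h))
    (by
      intro d hd z hz hdz
      have : z ∈ A ∪ C ∪ B := hU ▸ Set.mem_univ z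
      rcases this with (h | h) | h
      · exfalso
        have hcon := induce_union_connected hc₁.preconnected
          (induce_pair_connected_of_adj hdz).preconnected ⟨d, hd, by simp⟩
        have heq := hm₁ _ Set.subset_union_left (by
          rw [compl_compl]
          rintro w (hw | rfl | rfl)
          · exact hs₁ hw
          · exact hs₁ hd
          · exact h) hcon
        exact hz (heq ▸ Or.inr (by simp))
      · exact h
      · exact absurd hdz (hnad d (hs₁ hd) z h))
    k vf hvC hcov
  exact ⟨X, hX, fun x y hx hy P _ => hP x y hx hy P⟩

end Paper
end

section
/- Let G be a sparse graph that does not admit a star cutset. Then G is diamond-free, where a diamond is the graph obtained from K_4 by removing one edge. -/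
open SimpleGraph Set List

namespace Paper

lemma min_walk_induced {V : Type} (G : SimpleGraph V) (S : Set V) {u v : V} (p : G.Walk u v) :
    (∀ y ∈ p.support, y ∈ S) →
    (∀ q : G.Walk u v, (∀ y ∈ q.support, y ∈ S) → p.length ≤ q.length) →
    p.IsPath ∧ ∀ x ∈ p.support, ∀ y ∈ p.support, G.Adj x y → p.toSubgraph.Adj x y := by
  classical
  induction p with
  | nil =>
    intro _ _
    refine ⟨Walk.IsPath.nil, ?_⟩
    intro x hx y hy hxy
    simp only [Walk.support_nil, List.mem_singleton] at hx hy
    subst hx; subst hy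
    exact absurd hxy (G.loopless.irrefl _)
  | @cons u w v h p ih =>
    intro hS hmin
    have hSp : ∀ y ∈ p.support, y ∈ S := fun y hy => hS y (by simp [hy])
    have huS : u ∈ S := hS u (by simp)
    obtain ⟨hp, hind⟩ := ih hSp (by
      intro q hq
      have := hmin (Walk.cons h q) (by
        intro y hy
        rw [Walk.support_cons, List.mem_cons] at hy
        rcases hy with rfl | hy
        · exact huS
        · exact hq y hy)
      simpa using this)
    have hu : u ∉ p.support := by
      intro hu
      have h1 := hmin (p.dropUntil u hu)
        (fun y hy => hSp y (p.support_dropUntil_subset hu hy))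
      have h2 := p.length_dropUntil_le hu
      simp only [Walk.length_cons] at h1
      omega
    have key : ∀ y ∈ p.support, G.Adj u y → y = w := by
      intro y hy huy
      have h1 := hmin (Walk.cons huy (p.dropUntil y hy)) (by
        intro z hz
        rw [Walk.support_cons, List.mem_cons] at hz
        rcases hz with rfl | hz
        · exact huS
        · exact hSp z (p.support_dropUntil_subset hy hz))
      have h2 := congrArg Walk.length (p.take_spec hy)
      rw [Walk.length_append] at h2
      simp only [Walk.length_cons] at h1
      exact (Walk.eq_of_length_eq_zero (p := p.takeUntil y hy) (by omega)).symm
    refine ⟨hp.cons hu, ?_⟩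
    intro x hx y hy hxy
    rw [Walk.support_cons, List.mem_cons] at hx hy
    simp only [Walk.toSubgraph, Subgraph.sup_adj]
    rcases hx with rfl | hx
    · rcases hy with rfl | hy
      · exact absurd hxy (G.loopless.irrefl _)
      · left
        rw [key y hy hxy]
        simp
    · rcases hy with rfl | hy
      · left
        rw [key x hx hxy.symm]
        simp [Sym2.eq_swap]
      · right
        exact hind x hx y hy hxy

/-- Lemma `diamondlemma`: a sparse graph with no star cutset is
diamond-free. -/
theorem statement6 {V : Type} [Fintype V] (G : SimpleGraph V) (hG : Sparse G)
    (hns : ¬HasStarCutset G) :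
    ¬∃ a b c d : V, b ≠ d ∧ G.Adj a b ∧ G.Adj b c ∧ G.Adj c d ∧ G.Adj a d ∧
      G.Adj a c ∧ ¬G.Adj b d := by
  classical
  rintro ⟨a, b, c, d, hbd, hab, hbc, hcd, had, hac, hnbd⟩
  let S : Set V := {x | x = b ∨ x = d ∨ (x ≠ a ∧ ¬G.Adj a x)}
  have haS : a ∉ S := by
    rintro (h | h | h)
    · exact hab.ne h
    · exact had.ne h
    · exact h.1 rfl
  have hcS : c ∉ S := by
    rintro (h | h | h)
    · exact hbc.ne h.symm
    · exact hcd.ne h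
    · exact h.2 hac
  have hex : ∃ p : G.Walk b d, ∀ y ∈ p.support, y ∈ S := by
    by_contra hno
    apply hns
    let A : Set V := {x | ∃ p : G.Walk b x, ∀ y ∈ p.support, y ∈ S}
    have hAS : A ⊆ S := by
      rintro x ⟨p, hp⟩
      exact hp x p.end_mem_support
    refine ⟨A, Sᶜ, S \ A, ⟨?_, ?_, ?_, ?_, ?_⟩, ⟨b, Walk.nil, ?_⟩, ⟨d, ?_, hno⟩, a, haS, ?_⟩
    · ext x
      by_cases h1 : x ∈ S <;> by_cases h2 : x ∈ A <;> simp [h1, h2]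
    · exact Set.disjoint_left.2 fun x hx hx2 => hx2 (hAS hx)
    · exact Set.disjoint_left.2 fun x hx hx2 => hx2.2 hx
    · exact Set.disjoint_left.2 fun x hx hx2 => hx hx2.1
    · rintro x ⟨p, hp⟩ y ⟨hyS, hyA⟩ hxy
      apply hyA
      refine ⟨p.concat hxy, ?_⟩
      intro z hz
      rw [Walk.support_concat] at hz
      simp only [List.concat_eq_append, List.mem_append, List.mem_singleton] at hz
      rcases hz with hz | rfl
      · exact hp z hz
      · exact hyS
    · intro y hy
      simp only [Walk.support_nil, List.mem_singleton] at hy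
      exact Or.inl hy
    · exact Or.inr (Or.inl rfl)
    · intro x hx
      by_contra hx2
      apply hx
      right; right
      simp only [closedNbhd, Set.mem_insert_iff, mem_neighborSet, not_or] at hx2
      exact hx2
  have hex2 : ∃ n, ∃ p : G.Walk b d, (∀ y ∈ p.support, y ∈ S) ∧ p.length = n := by
    obtain ⟨p, hp⟩ := hex
    exact ⟨_, p, hp, rfl⟩
  obtain ⟨p, hpS, hpl⟩ := Nat.find_spec hex2
  obtain ⟨hpath, hind⟩ := min_walk_induced G S p hpS (by
    intro q hq
    rw [hpl]
    exact Nat.find_min' hex2 ⟨q, hq, rfl⟩)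
  have hap : a ∉ p.support := fun h => haS (hpS a h)
  have hlen : 2 ≤ p.length := by
    by_contra hlt
    have : p.length = 0 ∨ p.length = 1 := by omega
    rcases this with h | h
    · exact hbd (Walk.eq_of_length_eq_zero h)
    · exact hnbd (Walk.adj_of_length_eq_one h)
  have hsup : ∀ x, x ∈ (Walk.cons hab (p.concat had.symm)).support ↔ x = a ∨ x ∈ p.support := by
    intro x
    simp only [Walk.support_cons, Walk.support_concat, List.mem_cons, List.concat_eq_append,
      List.mem_append, List.mem_singleton, List.not_mem_nil]
    tauto
  have hadj1 : (Walk.cons hab (p.concat had.symm)).toSubgraph.Adj a b := by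
    simp [Walk.toSubgraph]
  have hadj2 : (Walk.cons hab (p.concat had.symm)).toSubgraph.Adj a d := by
    rw [Walk.adj_toSubgraph_iff_mem_edges]
    simp [Walk.edges_concat, Sym2.eq_swap]
  have hnb : ∀ y ∈ p.support, G.Adj a y → y = b ∨ y = d := by
    intro y hy hay
    rcases hpS y hy with h | h | h
    · exact Or.inl h
    · exact Or.inr h
    · exact absurd hay h.2
  have hhole : IsHole G (Walk.cons hab (p.concat had.symm)) := by
    refine ⟨?_, ?_, ?_⟩
    · rw [Walk.cons_isCycle_iff]
      refine ⟨hpath.concat hap _, ?_⟩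
      rw [Walk.edges_concat]
      simp only [List.concat_eq_append, List.mem_append, List.mem_singleton]
      rintro (h | h)
      · exact hap (p.fst_mem_support_of_mem_edges h)
      · rw [Sym2.eq_iff] at h
        rcases h with ⟨h, _⟩ | ⟨_, h⟩
        · exact had.ne h
        · exact hbd h
    · simp only [Walk.length_cons, Walk.length_concat]
      omega
    · intro x hx y hy hxy
      rw [Walk.mem_verts_toSubgraph, hsup] at hx hy
      rcases hx with rfl | hx
      · rcases hy with rfl | hy
        · exact absurd hxy (G.loopless.irrefl _)
        · rcases hnb y hy hxy with rfl | rfl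
          · exact hadj1
          · exact hadj2
      · rcases hy with rfl | hy
        · rcases hnb x hx hxy.symm with rfl | rfl
          · exact hadj1.symm
          · exact hadj2.symm
        · have := hind x hx y hy hxy
          rw [Walk.adj_toSubgraph_iff_mem_edges] at this ⊢
          simp [Walk.edges_concat, this]
  obtain ⟨e, f, -, hef⟩ := hG a _ hhole c (by
    rw [hsup]
    rintro (h | h)
    · exact hac.ne h.symm
    · exact hcS (hpS c h))
  have h1 := hef a ((hsup a).2 (Or.inl rfl)) hac.symm
  have h2 := hef b ((hsup b).2 (Or.inr p.start_mem_support)) hbc.symm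
  have h3 := hef d ((hsup d).2 (Or.inr p.end_mem_support)) hcd
  have n1 := hab.ne
  have n2 := had.ne
  grind


end Paper
end

section
/- Let x_1, x_2, x_3 be three distinct vertices of a graph G, and let H be a connected induced subgraph of G∖{x_1,x_2,x_3} such that V(H) contains at least one neighbor of each of x_1, x_2, x_3 and V(H) is minimal with this property under inclusion. Then one of the following holds: (i) for some distinct i,j,k ∈ {1,2,3}, there exists P that is either a path from x_i to x_j or a hole containing the edge x_ix_j, such that V(H) = V(P)∖{x_i,x_j}, and either x_k has two non-adjacent neighbors in H, or x_k has exactly two neighbors in H and they are adjacent; (ii) there exists a vertex a ∈ V(H) and three paths P_1, P_2, P_3, where P_i is from a to x_i, such that V(H) = (V(P_1) ∪ V(P_2) ∪ V(P_3))∖{x_1,x_2,x_3}, the sets V(P_i)∖{a} are pairwise disjoint, and for distinct i,j there are no edges between V(P_i)∖{a} and V(P_j)∖{a} except possibly x_ix_j; or (iii) there exists a triangle a_1a_2a_3 in H and three paths P_1, P_2, P_3, where P_i is from a_i to x_i, such that V(H) = (V(P_1) ∪ V(P_2) ∪ V(P_3))∖{x_1,x_2,x_3}, the sets V(P_1), V(P_2),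 V(P_3) are pairwise disjoint, and for distinct i,j there are no edges between V(P_i) and V(P_j) except a_ia_j and possibly x_ix_j. -/
open SimpleGraph Set List

namespace Paper

theorem iPath_nil (G : SimpleGraph V) (u : V) : IsIPath G (Walk.nil : G.Walk u u) := by
  refine ⟨by simp, ?_⟩
  intro a ha b hb hab
  simp at ha hb
  subst ha; subst hb
  exact (G.loopless.irrefl _ hab).elim

theorem iPath_cons {G : SimpleGraph V} {u v w : V} (h : G.Adj u v) (P : G.Walk v w) :
    IsIPath G (Walk.cons h P) ↔
      IsIPath G P ∧ u ∉ P.support ∧ ∀ y ∈ P.support, G.Adj u y → y = v := by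
  unfold IsIPath
  rw [Walk.cons_isPath_iff]
  constructor
  · rintro ⟨⟨h1, h2⟩, h3⟩
    refine ⟨⟨h1, ?_⟩, h2, ?_⟩
    · intro a ha b hb hab
      have h4 := @h3 a (by simp at ha ⊢; tauto) b (by simp at hb ⊢; tauto) hab
      simp only [Walk.toSubgraph, Subgraph.sup_adj, subgraphOfAdj_adj] at h4
      rcases h4 with h4 | h4
      · simp at ha hb
        rw [Sym2.eq_iff] at h4
        grind
      · exact h4
    · intro y hy huy
      have h4 := @h3 u (by simp) y (by simp [hy]) huy
      simp only [Walk.toSubgraph, Subgraph.sup_adj, subgraphOfAdj_adj] at h4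
      rcases h4 with h4 | h4
      · rw [Sym2.eq_iff] at h4
        grind
      · exact (h2 (by simpa using h4.fst_mem)).elim
  · rintro ⟨⟨h1, h2⟩, h3, h4⟩
    refine ⟨⟨h1, h3⟩, ?_⟩
    intro a ha b hb hab
    simp only [Walk.mem_verts_toSubgraph, Walk.support_cons, List.mem_cons] at ha hb
    simp only [Walk.toSubgraph, Subgraph.sup_adj, subgraphOfAdj_adj]
    rcases ha with rfl | ha <;> rcases hb with rfl | hb
    · exact (G.loopless.irrefl _ hab).elim
    · left; rw [h4 b hb hab]
    · left; rw [h4 a ha hab.symm, Sym2.eq_swap]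
    · right
      exact h2 (by simpa using ha) (by simpa using hb) hab

theorem iPath_rev {G : SimpleGraph V} {u v : V} {P : G.Walk u v} (h : IsIPath G P) :
    IsIPath G P.reverse := by
  refine ⟨h.1.reverse, ?_⟩
  rw [Walk.toSubgraph_reverse]; exact h.2

theorem iPath_append {G : SimpleGraph V} {u v w : V} (P : G.Walk u v) (Q : G.Walk v w) :
    IsIPath G (P.append Q) ↔ IsIPath G P ∧ IsIPath G Q ∧
      ∀ x ∈ P.support, ∀ y ∈ Q.support, (x = y → x = v) ∧ (G.Adj x y → x = v ∨ y = v) := by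
  induction P with
  | nil => simp [iPath_nil]
  | @cons a b c h P ih =>
    rw [Walk.cons_append, iPath_cons, iPath_cons, ih]
    simp only [Walk.mem_support_append_iff, Walk.support_cons, List.mem_cons]
    have e0 := P.start_mem_support
    have e1 := P.end_mem_support
    have e2 := Q.start_mem_support
    constructor
    · rintro ⟨⟨h1, h2, h3⟩, h4, h5⟩
      refine ⟨⟨h1, by tauto, fun y hy => h5 y (Or.inl hy)⟩, h2, ?_⟩
      rintro x (rfl | hx) y hy
      · grind
      · exact h3 x hx y hy
    · rintro ⟨⟨h1, h2, h3⟩, h4, h5⟩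
      refine ⟨⟨h1, h4, fun x hx => h5 x (Or.inr hx)⟩, ?_, ?_⟩
      · rintro (hh | hh)
        · exact h2 hh
        · have := (h5 a (Or.inl rfl) a hh).1 rfl
          grind
      · rintro y (hy | hy) hay
        · exact h3 y hy hay
        · have := (h5 a (Or.inl rfl) y hy).2 hay
          grind

theorem split_first {G : SimpleGraph V} (φ : V → Prop) {u v : V} (P : G.Walk u v)
    (h : ∃ y ∈ P.support, φ y) : ∃ (a : V) (A : G.Walk u a) (B : G.Walk a v),
      P = A.append B ∧ φ a ∧ ∀ y ∈ A.support, φ y → y = a := by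
  induction P with
  | @nil a =>
    refine ⟨a, Walk.nil, Walk.nil, by simp, by simpa using h, by simp⟩
  | @cons a b c hab P ih =>
    by_cases ha : φ a
    · exact ⟨a, Walk.nil, Walk.cons hab P, by simp, ha, by simp⟩
    · have : ∃ y ∈ P.support, φ y := by
        obtain ⟨y, hy, hy'⟩ := h
        simp at hy
        rcases hy with rfl | hy
        · exact (ha hy').elim
        · exact ⟨y, hy, hy'⟩
      obtain ⟨d, A, B, h1, h2, h3⟩ := ih this
      refine ⟨d, Walk.cons hab A, B, by simp [h1], h2, ?_⟩
      intro y hy hy'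
      simp at hy
      rcases hy with rfl | hy
      · exact (ha hy').elim
      · exact h3 y hy hy'

theorem split_last {G : SimpleGraph V} (φ : V → Prop) {u v : V} (P : G.Walk u v)
    (h : ∃ y ∈ P.support, φ y) : ∃ (a : V) (A : G.Walk u a) (B : G.Walk a v),
      P = A.append B ∧ φ a ∧ ∀ y ∈ B.support, φ y → y = a := by
  obtain ⟨a, A, B, h1, h2, h3⟩ := split_first φ P.reverse (by simpa using h)
  refine ⟨a, B.reverse, A.reverse, ?_, h2, by simpa using h3⟩
  rw [← Walk.reverse_append, ← h1, Walk.reverse_reverse]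

theorem exists_iPath {G : SimpleGraph V} {u v : V} (P : G.Walk u v) :
    ∃ Q : G.Walk u v, IsIPath G Q ∧ ∀ y ∈ Q.support, y ∈ P.support := by
  induction P with
  | nil => exact ⟨Walk.nil, iPath_nil _ _, by simp⟩
  | @cons a b c hab P ih =>
    obtain ⟨Q, hQ, hQP⟩ := ih
    obtain ⟨d, A, B, rfl, h2, h3⟩ := split_last (fun y => y = a ∨ G.Adj a y) Q
      ⟨b, by simp, Or.inr hab⟩
    rw [iPath_append] at hQ
    simp only [Walk.mem_support_append_iff] at hQP
    by_cases had : d = a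
    · subst had
      exact ⟨B, hQ.2.1, fun y hy => by simp [hQP y (Or.inr hy)]⟩
    · have hd : G.Adj a d := by tauto
      refine ⟨Walk.cons hd B, ?_, ?_⟩
      · rw [iPath_cons]
        refine ⟨hQ.2.1, ?_, ?_⟩
        · intro h; exact had (h3 a h (Or.inl rfl)).symm
        · intro y hy hay; exact h3 y hy (Or.inr hay)
      · intro y hy
        simp at hy ⊢
        rcases hy with rfl | hy
        · left; rfl
        · right; exact hQP y (Or.inr hy)

theorem exists_nice {G : SimpleGraph V} {H : Set V} (hc : (G.induce H).Connected)
    (φ ψ : V → Prop) (h1 : ∃ h ∈ H, φ h) (h2 : ∃ h ∈ H, ψ h) :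
    ∃ (u v : V) (P : G.Walk u v), IsIPath G P ∧ (∀ y ∈ P.support, y ∈ H) ∧ φ u ∧ ψ v ∧
      (∀ y ∈ P.support, φ y → y = u) ∧ (∀ y ∈ P.support, ψ y → y = v) := by
  obtain ⟨a, ha, hφ⟩ := h1
  obtain ⟨b, hb, hψ⟩ := h2
  obtain ⟨W⟩ := hc.preconnected ⟨a, ha⟩ ⟨b, hb⟩
  have key : ∀ (x y : H) (W : (G.induce H).Walk x y), ∃ P : G.Walk x.1 y.1,
      ∀ z ∈ P.support, z ∈ H := by
    intro x y W
    induction W with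
    | @nil x => exact ⟨Walk.nil, by simp⟩
    | @cons x y z h W ih =>
      obtain ⟨P, hP⟩ := ih
      refine ⟨Walk.cons (show G.Adj x.1 y.1 from h) P, ?_⟩
      intro w hw
      simp at hw
      rcases hw with rfl | hw
      · exact x.2
      · exact hP w hw
  obtain ⟨P, hP⟩ := key _ _ W
  obtain ⟨Q, hQ, hQP⟩ := exists_iPath P
  obtain ⟨u, A, B, rfl, hu, hB⟩ := split_last φ Q ⟨a, by simp, hφ⟩
  obtain ⟨v, C, D, rfl, hv, hC⟩ := split_first ψ B ⟨b, by simp, hψ⟩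
  simp only [iPath_append, Walk.mem_support_append_iff] at hQ hQP hB
  exact ⟨u, v, C, hQ.2.1.1, fun y hy => hP y (hQP y (by tauto)), hu, hv,
    fun y hy => hB y (by tauto), hC⟩

theorem no_triangle {G : SimpleGraph V} {u v : V} (P : G.Walk u v) (hP : IsIPath G P) :
    ∀ x ∈ P.support, ∀ y ∈ P.support, ∀ z ∈ P.support,
      G.Adj x y → G.Adj y z → G.Adj x z → False := by
  induction P with
  | nil => 
    intro x hx y hy z hz h1 h2 h3
    simp at hx hy
    subst hx; subst hy; exact G.loopless.irrefl _ h1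
  | @cons a b c h P ih =>
    rw [iPath_cons] at hP
    obtain ⟨hP, h1, h2⟩ := hP
    have ih := ih hP
    intro x hx y hy z hz hxy hyz hxz
    have n1 := hxy.ne
    have n2 := hyz.ne
    have n3 := hxz.ne
    have := hxy.symm
    have := hyz.symm
    have := hxz.symm
    simp only [Walk.support_cons, List.mem_cons] at hx hy hz
    grind

end Paper
namespace Paper

def Out1 (G : SimpleGraph V) (H : Set V) (x y z : V) : Prop :=
  ((∃ P : G.Walk x y, IsIPath G P ∧ H = {w | w ∈ P.support} \ {x, y}) ∨
   (∃ c : G.Walk x x, IsHole G c ∧ s(x, y) ∈ c.edges ∧ H = {w | w ∈ c.support} \ {x, y})) ∧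
  ((∃ p ∈ H, ∃ q ∈ H, p ≠ q ∧ ¬G.Adj p q ∧ G.Adj z p ∧ G.Adj z q) ∨
   (∃ p q : V, p ≠ q ∧ G.Adj p q ∧ {w | w ∈ H ∧ G.Adj z w} = {p, q}))

def Out2 (G : SimpleGraph V) (H : Set V) (x₁ x₂ x₃ : V) : Prop :=
  (∃ a ∈ H, ∃ (P₁ : G.Walk a x₁) (P₂ : G.Walk a x₂) (P₃ : G.Walk a x₃),
      IsIPath G P₁ ∧ IsIPath G P₂ ∧ IsIPath G P₃ ∧
      H = ({y | y ∈ P₁.support} ∪ {y | y ∈ P₂.support} ∪ {y | y ∈ P₃.support}) \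
        {x₁, x₂, x₃} ∧
      (∀ p ∈ P₁.support, p ≠ a → ∀ q ∈ P₂.support, q ≠ a →
        p ≠ q ∧ (G.Adj p q → p = x₁ ∧ q = x₂)) ∧
      (∀ p ∈ P₁.support, p ≠ a → ∀ q ∈ P₃.support, q ≠ a →
        p ≠ q ∧ (G.Adj p q → p = x₁ ∧ q = x₃)) ∧
      (∀ p ∈ P₂.support, p ≠ a → ∀ q ∈ P₃.support, q ≠ a →
        p ≠ q ∧ (G.Adj p q → p = x₂ ∧ q = x₃)))

theorem out2_swap12 {G : SimpleGraph V} {H : Set V} {x y z : V} (h : Out2 G H x y z) :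
    Out2 G H y x z := by
  obtain ⟨a, ha, P₁, P₂, P₃, h1, h2, h3, h4, h5, h6, h7⟩ := h
  refine ⟨a, ha, P₂, P₁, P₃, h2, h1, h3, ?_, ?_, h7, h6⟩
  · rw [h4]; ext w; simp only [Set.mem_sdiff, Set.mem_union, Set.mem_insert_iff]; tauto
  · intro p hp hpa q hq hqa
    have := h5 q hq hqa p hp hpa
    exact ⟨this.1.symm, fun h => (this.2 h.symm).symm⟩

theorem out2_swap23 {G : SimpleGraph V} {H : Set V} {x y z : V} (h : Out2 G H x y z) :
    Out2 G H x z y := by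
  obtain ⟨a, ha, P₁, P₂, P₃, h1, h2, h3, h4, h5, h6, h7⟩ := h
  refine ⟨a, ha, P₁, P₃, P₂, h1, h3, h2, ?_, h6, h5, ?_⟩
  · rw [h4]; ext w
    simp only [Set.mem_sdiff, Set.mem_union, Set.mem_insert_iff, Set.mem_singleton_iff]; tauto
  · intro p hp hpa q hq hqa
    have := h7 q hq hqa p hp hpa
    exact ⟨this.1.symm, fun h => (this.2 h.symm).symm⟩

/-- extend an induced path at its end -/
theorem iPath_ext {G : SimpleGraph V} {u v x : V} (P : G.Walk u v) (hP : IsIPath G P)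
    (h : G.Adj x v) (hx : x ∉ P.support) (hu : ∀ y ∈ P.support, G.Adj x y → y = v) :
    ∃ R : G.Walk u x, IsIPath G R ∧ (∀ y, y ∈ R.support ↔ y = x ∨ y ∈ P.support) ∧
      R.length = P.length + 1 := by
  refine ⟨(Walk.cons h P.reverse).reverse, iPath_rev ?_, ?_, ?_⟩
  · rw [iPath_cons]
    exact ⟨iPath_rev hP, by simpa using hx, by simpa using hu⟩
  · intro y; rw [Walk.support_reverse]; simp [or_comm]
  · simp

theorem caseA {G : SimpleGraph V} {H : Set V} {x y z u v : V} (hxy : x ≠ y) (hxz : x ≠ z)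
    (hyz : y ≠ z) (hx : x ∉ H) (hy : y ∉ H) (hz : z ∉ H) (P : G.Walk u v) (hP : IsIPath G P)
    (hH : ∀ w, w ∈ H ↔ w ∈ P.support) (hxu : G.Adj x u) (hyv : G.Adj y v)
    (hux : ∀ w ∈ P.support, G.Adj x w → w = u) (huy : ∀ w ∈ P.support, G.Adj y w → w = v)
    (hzn : ∃ w ∈ P.support, G.Adj z w) : Out1 G H x y z ∨ Out2 G H x y z := by
  obtain ⟨w, hw, hzw⟩ := hzn
  have e0 := P.start_mem_support
  have e1 := P.end_mem_support
  by_cases honly : ∀ w' ∈ P.support, G.Adj z w' → w' = w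
  · right
    obtain ⟨w', A, B, rfl, rfl, -⟩ := split_first (fun y => y = w) P ⟨w, hw, rfl⟩
    have hI := hP
    rw [iPath_append] at hI
    obtain ⟨hA, hB, hAB⟩ := hI
    simp only [Walk.mem_support_append_iff] at *
    obtain ⟨R₁, r1, r2, -⟩ := iPath_ext A.reverse (iPath_rev hA) hxu
      (by grind [Walk.support_reverse, List.mem_reverse])
      (by grind [Walk.support_reverse, List.mem_reverse])
    obtain ⟨R₂, r3, r4, -⟩ := iPath_ext B hB hyv (by grind) (by grind)
    simp only [Walk.support_reverse, List.mem_reverse] at r2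
    have r5 : IsIPath G (Walk.cons hzw.symm Walk.nil) := by
      rw [iPath_cons]
      refine ⟨iPath_nil _ _, ?_, ?_⟩ 
      · simpa using hzw.ne.symm
      · simp
    have s1 := A.start_mem_support
    have s2 := A.end_mem_support
    have s3 := B.start_mem_support
    have s4 := B.end_mem_support
    refine ⟨w', by grind, R₁, R₂, Walk.cons hzw.symm Walk.nil, r1, r3, r5, ?_, ?_, ?_, ?_⟩
    · ext t
      simp only [Set.mem_sdiff, Set.mem_union, Set.mem_ofPred_eq, Set.mem_insert_iff,
        Set.mem_singleton_iff, r2, r4, hH, Walk.support_cons, Walk.support_nil, List.mem_cons,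
        List.not_mem_nil]
      grind
    · intro p hp hpa q hq hqa
      rw [r2] at hp
      rw [r4] at hq
      have := G.adj_comm p q
      grind
    · intro p hp hpa q hq hqa
      rw [r2] at hp
      simp at hq
      have := G.adj_comm p q
      grind
    · intro p hp hpa q hq hqa
      rw [r4] at hp
      simp at hq
      have := G.adj_comm p q
      grind
  · left
    push Not at honly
    obtain ⟨w', hw', hzw', hne⟩ := honly
    have huv : u ≠ v := by
      rintro rfl
      have : P = Walk.nil := Walk.isPath_iff_eq_nil.1 hP.1
      subst this
      simp at hw hw'
      grind
    refine ⟨?_, ?_⟩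
    · by_cases hadj : G.Adj x y
      · right
        have hc1 : IsIPath G (Walk.cons hxu P) := by
          rw [iPath_cons]; exact ⟨hP, by grind, hux⟩
        have hc2 : y ∉ (Walk.cons hxu P).support := by
          simp only [Walk.support_cons, List.mem_cons]; grind
        have hlen : P.length ≠ 0 := fun h => huv (Walk.eq_of_length_eq_zero h)
        refine ⟨Walk.cons hadj (Walk.cons hyv (Walk.cons hxu P).reverse), ⟨?_, ?_, ?_⟩, ?_, ?_⟩
        · rw [Walk.cons_isCycle_iff]
          refine ⟨?_, ?_⟩
          · rw [Walk.cons_isPath_iff]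
            refine ⟨hc1.1.reverse, by rw [Walk.support_reverse, List.mem_reverse]; exact hc2⟩
          · rw [Walk.edges_cons, List.mem_cons, Walk.edges_reverse, List.mem_reverse]
            rintro (h | h)
            · rw [Sym2.eq_iff] at h
              grind
            · exact hc2 (Walk.snd_mem_support_of_mem_edges _ h)
        · simp only [Walk.length_cons, Walk.length_reverse]; omega
        · intro a ha b hb hab
          have mem : ∀ t, t ∈ (Walk.cons hadj (Walk.cons hyv (Walk.cons hxu P).reverse)).toSubgraph.verts
              → t = y ∨ t ∈ (Walk.cons hxu P).support := by
            intro t ht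
            rw [Walk.mem_verts_toSubgraph, Walk.support_cons, Walk.support_cons,
              Walk.support_reverse] at ht
            simp only [List.mem_cons, List.mem_reverse, Walk.support_cons] at ht ⊢
            tauto
          rw [Walk.toSubgraph, Walk.toSubgraph, Walk.toSubgraph_reverse]
          simp only [Subgraph.sup_adj, subgraphOfAdj_adj]
          have nb : ∀ t ∈ (Walk.cons hxu P).support, G.Adj y t → t = x ∨ t = v := by
            intro t ht hyt
            simp only [List.mem_cons, Walk.support_cons] at ht
            grind
          rcases mem a ha with rfl | ha' <;> rcases mem b hb with rfl | hb'
          · exact (G.loopless.irrefl _ hab).elim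
          · rcases nb b hb' hab with rfl | rfl
            · left; exact Sym2.eq_swap
            · right; left; rfl
          · rcases nb a ha' hab.symm with rfl | rfl
            · left; rfl
            · right; left; exact Sym2.eq_swap
          · right; right
            exact hc1.2 ((Walk.mem_verts_toSubgraph _).2 ha') ((Walk.mem_verts_toSubgraph _).2 hb') hab
        · simp
        · ext t
          simp only [Set.mem_sdiff, Set.mem_ofPred_eq, Set.mem_insert_iff,
            Set.mem_singleton_iff, hH, Walk.support_cons, Walk.support_reverse, List.mem_cons,
            List.mem_reverse]
          grind
      · left
        obtain ⟨R, r1, r2, -⟩ := iPath_ext P hP hyv (by grind) (by grind)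
        refine ⟨Walk.cons hxu R, ?_, ?_⟩
        · rw [iPath_cons]
          refine ⟨r1, ?_, ?_⟩
          · rw [r2]; grind
          · intro t ht hxt
            rw [r2] at ht
            grind
        · ext t
          simp only [Set.mem_sdiff, Set.mem_ofPred_eq, Set.mem_insert_iff,
            Set.mem_singleton_iff, hH, Walk.support_cons, List.mem_cons, r2]
          grind
    · by_cases hall : ∀ p ∈ P.support, ∀ q ∈ P.support, G.Adj z p → G.Adj z q → p ≠ q → G.Adj p q
      · right
        refine ⟨w, w', hne.symm, hall w hw w' hw' hzw hzw' hne.symm, ?_⟩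
        ext t
        simp only [Set.mem_ofPred_eq, Set.mem_insert_iff, Set.mem_singleton_iff, hH]
        constructor
        · rintro ⟨ht, hzt⟩
          by_contra hcon
          push Not at hcon
          exact no_triangle P hP w hw w' hw' t ht (hall _ hw _ hw' hzw hzw' hne.symm)
            (hall _ hw' _ ht hzw' hzt hcon.2.symm) (hall _ hw _ ht hzw hzt hcon.1.symm)
        · rintro (rfl | rfl) <;> tauto
      · left
        push Not at hall
        obtain ⟨p, hp, q, hq, h1, h2, h3, h4⟩ := hall
        exact ⟨p, (hH p).2 hp, q, (hH q).2 hq, h3, h4, h1, h2⟩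

end Paper
namespace Paper

def Mn (G : SimpleGraph V) (H : Set V) (x y z : V) : Prop :=
  ∀ H' ⊆ H, (G.induce H').Connected →
      (∃ h ∈ H', G.Adj x h) → (∃ h ∈ H', G.Adj y h) → (∃ h ∈ H', G.Adj z h) → H' = H

def Sup {G : SimpleGraph V} {u v : V} (P : G.Walk u v) : Set V := {w | w ∈ P.support}

theorem sup_mem {G : SimpleGraph V} {u v : V} (P : G.Walk u v) (w : V) :
    w ∈ Sup P ↔ w ∈ P.support := Iff.rfl

theorem sup_conn {G : SimpleGraph V} {u v : V} (P : G.Walk u v) :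
    (G.induce (Sup P)).Connected := P.connected_induce_support

theorem union_conn {G : SimpleGraph V} {S T : Set V} (hS : (G.induce S).Connected)
    (hT : (G.induce T).Connected) {a b : V} (ha : a ∈ S) (hb : b ∈ T) (hab : G.Adj a b) :
    (G.induce (S ∪ T)).Connected :=
  connected_induce_union hS.preconnected hT.preconnected ha hb hab

theorem exists_Q {G : SimpleGraph V} {H : Set V} {z u v : V} (hc : (G.induce H).Connected)
    (P : G.Walk u v) (hPH : ∀ w ∈ P.support, w ∈ H) (hz : ∃ h ∈ H, G.Adj z h)
    (hzP : ∀ w ∈ P.support, ¬ G.Adj z w) :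
    ∃ (q r : V) (Q : G.Walk q r), IsIPath G Q ∧ (∀ y ∈ Q.support, y ∈ H ∧ y ∉ P.support) ∧
      (∃ p ∈ P.support, G.Adj q p) ∧ G.Adj z r ∧ (∀ y ∈ Q.support, G.Adj z y → y = r) ∧
      (∀ y ∈ Q.support, ∀ p ∈ P.support, G.Adj y p → y = q) := by
  obtain ⟨s, r, R, hR, hRH, hs, hr, hRs, hRr⟩ := exists_nice hc (fun w => w ∈ P.support)
    (fun w => G.Adj z w) ⟨u, hPH u (by simp), by simp⟩ hz
  cases R with
  | nil => exact (hzP _ hs hr).elim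
  | @cons _ b _ h R =>
    rw [iPath_cons] at hR
    obtain ⟨hR, h1, h2⟩ := hR
    simp only [Walk.support_cons, List.mem_cons] at *
    obtain ⟨q, A, B, rfl, hq, hB⟩ := split_last (fun w => ∃ p ∈ P.support, G.Adj w p) R
      ⟨b, by simp, s, hs, h.symm⟩
    rw [iPath_append] at hR
    simp only [Walk.mem_support_append_iff] at *
    refine ⟨q, r, B, hR.2.1, ?_, hq, hr, ?_, ?_⟩
    · intro y hy
      refine ⟨by grind, fun hyP => ?_⟩
      have := hRs y (by grind) hyP
      subst this
      exact h1 (Or.inr hy)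
    · intro y hy; exact hRr y (by grind)
    · intro y hy p hp hyp; exact hB y hy ⟨p, hp, hyp⟩

theorem caseL {G : SimpleGraph V} {H : Set V} {x y z u v q r : V} (hxy : x ≠ y) (hxz : x ≠ z)
    (hyz : y ≠ z) (hx : x ∉ H) (hy : y ∉ H) (hz : z ∉ H) (hm : Mn G H x y z)
    (P : G.Walk u v) (hP : IsIPath G P)
    (hPH : ∀ w ∈ P.support, w ∈ H) (hxu : G.Adj x u) (hyv : G.Adj y v)
    (huy : ∀ w ∈ P.support, G.Adj y w → w = v)
    (hzP : ∀ w ∈ P.support, ¬ G.Adj z w)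
    (Q : G.Walk q r) (hQ : IsIPath G Q) (hQH : ∀ y ∈ Q.support, y ∈ H ∧ y ∉ P.support)
    (hqP : ∃ p ∈ P.support, G.Adj q p) (hzr : G.Adj z r)
    (hQz : ∀ y ∈ Q.support, G.Adj z y → y = r)
    (hQP : ∀ y ∈ Q.support, ∀ p ∈ P.support, G.Adj y p → y = q)
    (hxQ : ∃ w ∈ Q.support, G.Adj x w) : Out1 G H z y x ∨ Out2 G H z y x := by
  have e1 := P.start_mem_support
  have e2 := P.end_mem_support
  have e3 := Q.start_mem_support
  have e4 := Q.end_mem_support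
  have hyQ : ∀ w ∈ Q.support, ¬ G.Adj y w := by
    intro w hw hyw
    have := hm (Sup Q) (fun t ht => (hQH t ht).1) (sup_conn Q) hxQ ⟨w, hw, hyw⟩ ⟨r, e4, hzr⟩
    have h2 : u ∈ Sup Q := this ▸ hPH u e1
    exact (hQH u h2).2 e1
  obtain ⟨t, A, B, rfl, hqt, hB⟩ := split_last (fun w => G.Adj q w) P hqP
  have hI := hP
  rw [iPath_append] at hI
  obtain ⟨-, hBp, hAB⟩ := hI
  simp only [Walk.mem_support_append_iff] at *
  have f1 := A.start_mem_support
  have f3 := B.start_mem_support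
  have f4 := B.end_mem_support
  have hHe := hm (Sup B ∪ Sup Q) (by
      intro w hw
      simp only [Set.mem_union, sup_mem] at hw
      grind) (union_conn (sup_conn B) (sup_conn Q) (a := t) (b := q) f3 e3 hqt.symm)
    (by obtain ⟨w, hw, hw'⟩ := hxQ; exact ⟨w, Or.inr hw, hw'⟩) ⟨v, Or.inl f4, hyv⟩
    ⟨r, Or.inr e4, hzr⟩
  have hHm : ∀ w, w ∈ H ↔ w ∈ B.support ∨ w ∈ Q.support := by
    intro w; rw [← hHe]; rfl
  have hut : u = t := by
    have := (hHm u).1 (hPH u e1)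
    grind
  have hR : IsIPath G (Q.reverse.append (Walk.cons hqt B)) := by
    rw [iPath_append, iPath_cons]
    refine ⟨iPath_rev hQ, ⟨hBp, by grind, hB⟩, ?_⟩
    simp only [Walk.support_reverse, List.mem_reverse, Walk.support_cons, List.mem_cons]
    intro a ha b hb
    grind
  have hRs : ∀ w, w ∈ (Q.reverse.append (Walk.cons hqt B)).support ↔
      w ∈ B.support ∨ w ∈ Q.support := by
    intro w
    simp only [Walk.mem_support_append_iff, Walk.support_reverse, List.mem_reverse,
      Walk.support_cons, List.mem_cons]
    grind
  refine caseA hyz.symm hxz.symm hxy.symm hz hy hx _ hR (by grind) hzr hyv ?_ ?_ ?_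
  · intro w hw; rw [hRs] at hw; grind
  · intro w hw; rw [hRs] at hw; grind
  · exact ⟨t, by rw [hRs]; grind, by grind⟩

def Out3 (G : SimpleGraph V) (H : Set V) (x₁ x₂ x₃ : V) : Prop :=
    (∃ a₁ ∈ H, ∃ a₂ ∈ H, ∃ a₃ ∈ H, G.Adj a₁ a₂ ∧ G.Adj a₂ a₃ ∧ G.Adj a₁ a₃ ∧
      ∃ (P₁ : G.Walk a₁ x₁) (P₂ : G.Walk a₂ x₂) (P₃ : G.Walk a₃ x₃),
      IsIPath G P₁ ∧ IsIPath G P₂ ∧ IsIPath G P₃ ∧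
      H = ({y | y ∈ P₁.support} ∪ {y | y ∈ P₂.support} ∪ {y | y ∈ P₃.support}) \
        {x₁, x₂, x₃} ∧
      (∀ p ∈ P₁.support, ∀ q ∈ P₂.support,
        p ≠ q ∧ (G.Adj p q → (p = a₁ ∧ q = a₂) ∨ (p = x₁ ∧ q = x₂))) ∧
      (∀ p ∈ P₁.support, ∀ q ∈ P₃.support,
        p ≠ q ∧ (G.Adj p q → (p = a₁ ∧ q = a₃) ∨ (p = x₁ ∧ q = x₃))) ∧
      (∀ p ∈ P₂.support, ∀ q ∈ P₃.support,
        p ≠ q ∧ (G.Adj p q → (p = a₂ ∧ q = a₃) ∨ (p = x₂ ∧ q = x₃))))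

set_option maxHeartbeats 2000000 in
theorem caseF {G : SimpleGraph V} {H : Set V} {x y z u v q r : V} (hxy : x ≠ y) (hxz : x ≠ z)
    (hyz : y ≠ z) (hx : x ∉ H) (hy : y ∉ H) (hz : z ∉ H) (hm : Mn G H x y z)
    (P : G.Walk u v) (hP : IsIPath G P)
    (hPH : ∀ w ∈ P.support, w ∈ H) (hxu : G.Adj x u) (hyv : G.Adj y v)
    (hux : ∀ w ∈ P.support, G.Adj x w → w = u)
    (huy : ∀ w ∈ P.support, G.Adj y w → w = v)
    (hzP : ∀ w ∈ P.support, ¬ G.Adj z w)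
    (Q : G.Walk q r) (hQ : IsIPath G Q) (hQH : ∀ y ∈ Q.support, y ∈ H ∧ y ∉ P.support)
    (hqP : ∃ p ∈ P.support, G.Adj q p) (hzr : G.Adj z r)
    (hQz : ∀ y ∈ Q.support, G.Adj z y → y = r)
    (hQP : ∀ y ∈ Q.support, ∀ p ∈ P.support, G.Adj y p → y = q)
    (hxQ : ∀ w ∈ Q.support, ¬ G.Adj x w) (hyQ : ∀ w ∈ Q.support, ¬ G.Adj y w) :
    Out2 G H x y z ∨ Out3 G H x y z := by
  have e3 := Q.start_mem_support
  have e4 := Q.end_mem_support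
  obtain ⟨s, A, B, rfl, hqs, hAs⟩ := split_first (fun w => G.Adj q w) P hqP
  obtain ⟨t, M, C, rfl, hqt, hCt⟩ := split_last (fun w => G.Adj q w) B ⟨s, by simp, hqs⟩
  rw [iPath_append, iPath_append] at hP
  obtain ⟨hA, ⟨hM, hC, hMC⟩, hAB⟩ := hP
  simp only [Walk.mem_support_append_iff] at *
  have f1 := A.start_mem_support
  have f2 := A.end_mem_support
  have f3 := C.start_mem_support
  have f4 := C.end_mem_support
  have f5 := M.start_mem_support
  have f6 := M.end_mem_support
  have hHe := hm ((Sup A ∪ Sup Q) ∪ Sup C) (by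
      intro w hw
      simp only [Set.mem_union, sup_mem] at hw
      grind) (union_conn (union_conn (sup_conn A) (sup_conn Q) (a := s) (b := q) f2 e3 hqs.symm)
        (sup_conn C) (a := q) (b := t) (Or.inr e3) f3 hqt)
    ⟨u, Or.inl (Or.inl f1), hxu⟩ ⟨v, Or.inr f4, hyv⟩ ⟨r, Or.inl (Or.inr e4), hzr⟩
  have hHm : ∀ w, w ∈ H ↔ w ∈ A.support ∨ w ∈ Q.support ∨ w ∈ C.support := by
    intro w; rw [← hHe]; simp only [Set.mem_union, sup_mem, or_assoc]
  obtain ⟨R₁, r1, r2, -⟩ := iPath_ext A.reverse (iPath_rev hA) hxu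
      (by grind [Walk.support_reverse])
      (by grind [Walk.support_reverse])
  simp only [Walk.support_reverse, List.mem_reverse] at r2
  obtain ⟨R₂, r3, r4, -⟩ := iPath_ext C hC hyv (by grind) (by grind)
  obtain ⟨R₃, r5, r6, -⟩ := iPath_ext Q hQ hzr (by grind) (by grind)
  by_cases hst : s = t
  · left
    subst hst
    have r7 : IsIPath G (Walk.cons hqs.symm R₃) := by
      rw [iPath_cons]
      refine ⟨r5, by rw [r6]; grind, ?_⟩
      intro w hw
      rw [r6] at hw
      have := G.adj_comm s w
      grind
    refine ⟨s, by grind, R₁, R₂, Walk.cons hqs.symm R₃, r1, r3, r7, ?_, ?_, ?_, ?_⟩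
    · ext w
      simp only [Set.mem_sdiff, Set.mem_union, Set.mem_ofPred_eq, Set.mem_insert_iff,
        Set.mem_singleton_iff, r2, r4, r6, hHm, Walk.support_cons, List.mem_cons]
      grind
    · intro p hp hpa q' hq hqa
      rw [r2] at hp
      rw [r4] at hq
      have := G.adj_comm p q'
      grind
    · intro p hp hpa q' hq hqa
      rw [r2] at hp
      simp only [Walk.support_cons, List.mem_cons, r6] at hq
      have := G.adj_comm p q'
      grind
    · intro p hp hpa q' hq hqa
      rw [r4] at hp
      simp only [Walk.support_cons, List.mem_cons, r6] at hq
      have := G.adj_comm p q'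
      grind
  · right
    have hadj : G.Adj s t := by
      cases M with
      | nil => exact (hst rfl).elim
      | @cons _ b _ h M =>
        rw [iPath_cons] at hM
        have hb := M.start_mem_support
        simp only [Walk.support_cons, List.mem_cons] at *
        have hbH := (hHm b).1 (hPH b (by tauto))
        have hne := h.ne
        have hb' : b = t := by
          rcases hbH with hb1 | hb1 | hb1
          · have := (hAB b hb1 b (by tauto)).1 rfl
            grind
          · have := (hQH b hb1).2
            tauto
          · exact (hMC b (by tauto) b hb1).1 rfl
        exact hb' ▸ h
    have hsC : s ∉ C.support := fun h => hst ((hMC s f5 s h).1 rfl)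
    have htA : t ∉ A.support := fun h => hst ((hAB t h t (Or.inl f6)).1 rfl).symm
    have hAC : ∀ a ∈ A.support, ∀ c ∈ C.support, a ≠ c ∧ (G.Adj a c → a = s ∧ c = t) := by
      intro a ha c hc
      have k1 := hAB a ha c (Or.inr hc)
      have k2 := hMC s f5 c hc
      grind
    clear hAB hMC
    refine ⟨s, (hHm s).2 (by tauto), t, (hHm t).2 (by tauto), q, (hHm q).2 (by tauto), hadj, hqt.symm, hqs.symm, R₁, R₂, R₃,
      r1, r3, r5, ?_, ?_, ?_, ?_⟩
    · ext w
      simp only [Set.mem_sdiff, Set.mem_union, Set.mem_ofPred_eq, Set.mem_insert_iff,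
        Set.mem_singleton_iff, r2, r4, r6, hHm]
      grind
    · intro p hp q' hq
      rw [r2] at hp
      rw [r4] at hq
      have := G.adj_comm p q'
      grind
    · intro p hp q' hq
      rw [r2] at hp
      rw [r6] at hq
      have := G.adj_comm p q'
      grind
    · intro p hp q' hq
      rw [r4] at hp
      rw [r6] at hq
      have := G.adj_comm p q'
      grind

theorem main_aux {G : SimpleGraph V} {H : Set V} {x y z : V} (hxy : x ≠ y) (hxz : x ≠ z)
    (hyz : y ≠ z) (hx : x ∉ H) (hy : y ∉ H) (hz : z ∉ H) (hc : (G.induce H).Connected)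
    (h1 : ∃ h ∈ H, G.Adj x h) (h2 : ∃ h ∈ H, G.Adj y h) (h3 : ∃ h ∈ H, G.Adj z h)
    (hm : Mn G H x y z) :
    (Out1 G H x y z ∨ Out1 G H z y x ∨ Out1 G H z x y) ∨ Out2 G H x y z ∨ Out3 G H x y z := by
  obtain ⟨u, v, P, hP, hPH, hxu, hyv, hux, huy⟩ := exists_nice hc (fun w => G.Adj x w)
    (fun w => G.Adj y w) h1 h2
  by_cases hzP : ∃ w ∈ P.support, G.Adj z w
  · have hHe := hm (Sup P) hPH (sup_conn P) ⟨u, P.start_mem_support, hxu⟩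
      ⟨v, P.end_mem_support, hyv⟩ hzP
    have := caseA hxy hxz hyz hx hy hz P hP (fun w => by rw [← hHe]; rfl) hxu hyv hux huy hzP
    tauto
  · push Not at hzP
    obtain ⟨q, r, Q, hQ, hQH, hqP, hzr, hQz, hQP⟩ := exists_Q hc P hPH h3 hzP
    by_cases hxQ : ∃ w ∈ Q.support, G.Adj x w
    · have := caseL hxy hxz hyz hx hy hz hm P hP hPH hxu hyv huy hzP Q hQ hQH hqP hzr hQz hQP hxQ
      rcases this with h | h
      · tauto
      · right; left
        exact out2_swap12 (out2_swap23 (out2_swap12 h))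
    · by_cases hyQ : ∃ w ∈ Q.support, G.Adj y w
      · have := caseL (P := P.reverse) hxy.symm hyz hxz hy hx hz
          (fun H' a b c d e => hm H' a b d c e) (iPath_rev hP)
          (by simpa using hPH) hyv hxu (by simpa using hux) (by simpa using hzP) Q hQ
          (by simpa using hQH) (by simpa using hqP) hzr hQz (by simpa using hQP) hyQ
        rcases this with h | h
        · tauto
        · right; left
          exact out2_swap23 (out2_swap12 h)
      · push Not at hxQ hyQ
        right
        exact caseF hxy hxz hyz hx hy hz hm P hP hPH hxu hyv hux huy hzP Q hQ hQH hqP hzr hQz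
          hQP hxQ hyQ

theorem out1_perm {G : SimpleGraph V} {H : Set V} {x₁ x₂ x₃ x y z : V} (h : Out1 G H x y z)
    (σ : Equiv.Perm (Fin 3)) (h0 : ![x₁, x₂, x₃] (σ 0) = x) (h1 : ![x₁, x₂, x₃] (σ 1) = y)
    (h2 : ![x₁, x₂, x₃] (σ 2) = z) :
    Out1 G H (![x₁, x₂, x₃] (σ 0)) (![x₁, x₂, x₃] (σ 1)) (![x₁, x₂, x₃] (σ 2)) := by
  rw [h0, h1, h2]; exact h

end Paper
namespace Paper

/-- Lemma `minimalconnected`. -/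
theorem statement7 {V : Type} [Fintype V] (G : SimpleGraph V) (x₁ x₂ x₃ : V)
    (h12 : x₁ ≠ x₂) (h13 : x₁ ≠ x₃) (h23 : x₂ ≠ x₃)
    (H : Set V) (hx1 : x₁ ∉ H) (hx2 : x₂ ∉ H) (hx3 : x₃ ∉ H)
    (hconn : (G.induce H).Connected)
    (hn1 : ∃ h ∈ H, G.Adj x₁ h) (hn2 : ∃ h ∈ H, G.Adj x₂ h) (hn3 : ∃ h ∈ H, G.Adj x₃ h)
    (hmin : ∀ H' ⊆ H, (G.induce H').Connected →
      (∃ h ∈ H', G.Adj x₁ h) → (∃ h ∈ H', G.Adj x₂ h) → (∃ h ∈ H', G.Adj x₃ h) →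
        H' = H) :
    -- Outcome (i)
    (∃ σ : Equiv.Perm (Fin 3),
      ((∃ P : G.Walk (![x₁, x₂, x₃] (σ 0)) (![x₁, x₂, x₃] (σ 1)), IsIPath G P ∧
          H = {y | y ∈ P.support} \ {![x₁, x₂, x₃] (σ 0), ![x₁, x₂, x₃] (σ 1)}) ∨
       (∃ c : G.Walk (![x₁, x₂, x₃] (σ 0)) (![x₁, x₂, x₃] (σ 0)), IsHole G c ∧
          s(![x₁, x₂, x₃] (σ 0), ![x₁, x₂, x₃] (σ 1)) ∈ c.edges ∧
          H = {y | y ∈ c.support} \ {![x₁, x₂, x₃] (σ 0), ![x₁, x₂, x₃] (σ 1)})) ∧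
      ((∃ p ∈ H, ∃ q ∈ H, p ≠ q ∧ ¬G.Adj p q ∧
          G.Adj (![x₁, x₂, x₃] (σ 2)) p ∧ G.Adj (![x₁, x₂, x₃] (σ 2)) q) ∨
       (∃ p q : V, p ≠ q ∧ G.Adj p q ∧
          {y | y ∈ H ∧ G.Adj (![x₁, x₂, x₃] (σ 2)) y} = {p, q}))) ∨
    -- Outcome (ii)
    (∃ a ∈ H, ∃ (P₁ : G.Walk a x₁) (P₂ : G.Walk a x₂) (P₃ : G.Walk a x₃),
      IsIPath G P₁ ∧ IsIPath G P₂ ∧ IsIPath G P₃ ∧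
      H = ({y | y ∈ P₁.support} ∪ {y | y ∈ P₂.support} ∪ {y | y ∈ P₃.support}) \
        {x₁, x₂, x₃} ∧
      (∀ p ∈ P₁.support, p ≠ a → ∀ q ∈ P₂.support, q ≠ a →
        p ≠ q ∧ (G.Adj p q → p = x₁ ∧ q = x₂)) ∧
      (∀ p ∈ P₁.support, p ≠ a → ∀ q ∈ P₃.support, q ≠ a →
        p ≠ q ∧ (G.Adj p q → p = x₁ ∧ q = x₃)) ∧
      (∀ p ∈ P₂.support, p ≠ a → ∀ q ∈ P₃.support, q ≠ a →
        p ≠ q ∧ (G.Adj p q → p = x₂ ∧ q = x₃))) ∨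
    -- Outcome (iii)
    (∃ a₁ ∈ H, ∃ a₂ ∈ H, ∃ a₃ ∈ H, G.Adj a₁ a₂ ∧ G.Adj a₂ a₃ ∧ G.Adj a₁ a₃ ∧
      ∃ (P₁ : G.Walk a₁ x₁) (P₂ : G.Walk a₂ x₂) (P₃ : G.Walk a₃ x₃),
      IsIPath G P₁ ∧ IsIPath G P₂ ∧ IsIPath G P₃ ∧
      H = ({y | y ∈ P₁.support} ∪ {y | y ∈ P₂.support} ∪ {y | y ∈ P₃.support}) \
        {x₁, x₂, x₃} ∧
      (∀ p ∈ P₁.support, ∀ q ∈ P₂.support,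
        p ≠ q ∧ (G.Adj p q → (p = a₁ ∧ q = a₂) ∨ (p = x₁ ∧ q = x₂))) ∧
      (∀ p ∈ P₁.support, ∀ q ∈ P₃.support,
        p ≠ q ∧ (G.Adj p q → (p = a₁ ∧ q = a₃) ∨ (p = x₁ ∧ q = x₃))) ∧
      (∀ p ∈ P₂.support, ∀ q ∈ P₃.support,
        p ≠ q ∧ (G.Adj p q → (p = a₂ ∧ q = a₃) ∨ (p = x₂ ∧ q = x₃)))) := by
  rcases main_aux h12 h13 h23 hx1 hx2 hx3 hconn hn1 hn2 hn3 hmin with (h | h | h) | h | h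
  · exact Or.inl ⟨1, out1_perm h 1 rfl rfl rfl⟩
  · exact Or.inl ⟨Equiv.swap 0 2, out1_perm h (Equiv.swap 0 2) rfl rfl rfl⟩
  · exact Or.inl ⟨finRotate 3 * finRotate 3, out1_perm h (finRotate 3 * finRotate 3) rfl rfl rfl⟩
  · exact Or.inr (Or.inl h)
  · exact Or.inr (Or.inr h)

end Paper
end

section
/- Let G be a very sparse graph. Then either G has no triangle (and hence G ∈ F_2), or G is a complete graph, or G admits a star cutset. -/
open SimpleGraph Set List

namespace Paper


section Helpers

variable {U : Type} {G : SimpleGraph U}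

theorem ipath_nil (u : U) : IsIPath G (Walk.nil : G.Walk u u) := by
  refine ⟨Walk.IsPath.nil, ?_⟩
  intro a ha b hb hab
  simp at ha hb
  subst ha; subst hb
  exact absurd hab (G.loopless.irrefl _)

theorem ipath_cons_iff {u v w : U} (h : G.Adj u v) (P : G.Walk v w) :
    IsIPath G (Walk.cons h P) ↔
      IsIPath G P ∧ u ∉ P.support ∧ ∀ y ∈ P.support, G.Adj u y → y = v := by
  constructor
  · rintro ⟨h1, h2⟩
    rw [Walk.cons_isPath_iff] at h1
    have key : ∀ a b, (Walk.cons h P).toSubgraph.Adj a b →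
        (a = u ∧ b = v) ∨ (a = v ∧ b = u) ∨ P.toSubgraph.Adj a b := by
      intro a b hab
      simp only [Walk.toSubgraph, Subgraph.sup_adj, subgraphOfAdj_adj, Sym2.eq_iff] at hab
      grind
    have hs : ∀ a, a ∈ P.support → a ∈ (Walk.cons h P).toSubgraph.verts := by
      intro a ha
      rw [Walk.mem_verts_toSubgraph, Walk.support_cons]
      exact List.mem_cons_of_mem _ ha
    have hu : u ∈ (Walk.cons h P).toSubgraph.verts := by
      rw [Walk.mem_verts_toSubgraph]; simp
    refine ⟨⟨h1.1, ?_⟩, h1.2, ?_⟩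
    · intro a ha b hb hab
      rw [Walk.mem_verts_toSubgraph] at ha hb
      rcases key a b (h2 (hs a ha) (hs b hb) hab) with ⟨e, -⟩ | ⟨-, e⟩ | e
      · exact absurd (e ▸ ha) h1.2
      · exact absurd (e ▸ hb) h1.2
      · exact e
    · intro y hy hay
      rcases key u y (h2 hu (hs y hy) hay) with ⟨-, e⟩ | ⟨-, e⟩ | e
      · exact e
      · exact absurd (e ▸ hy) h1.2
      · have := e.fst_mem
        rw [Walk.mem_verts_toSubgraph] at this
        exact absurd this h1.2
  · rintro ⟨⟨h1, h2⟩, h3, h4⟩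
    refine ⟨(Walk.cons_isPath_iff _ _).2 ⟨h1, h3⟩, ?_⟩
    intro a ha b hb hab
    rw [Walk.mem_verts_toSubgraph, Walk.support_cons, List.mem_cons] at ha hb
    simp only [Walk.toSubgraph, Subgraph.sup_adj, subgraphOfAdj_adj, Sym2.eq_iff]
    rcases ha with ha | ha <;> rcases hb with hb | hb
    · subst ha; subst hb; exact absurd hab (G.loopless.irrefl _)
    · subst ha; left; left; exact ⟨rfl, (h4 b hb hab).symm⟩
    · subst hb; left; right; exact ⟨rfl, (h4 a ha hab.symm).symm⟩
    · right
      exact h2 (by rwa [Walk.mem_verts_toSubgraph]) (by rwa [Walk.mem_verts_toSubgraph]) hab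

theorem ipath_reverse {u v : U} {P : G.Walk u v} (h : IsIPath G P) : IsIPath G P.reverse :=
  ⟨h.1.reverse, by rw [Walk.toSubgraph_reverse]; exact h.2⟩

theorem sparse_use (hs : Sparse G) {u v x z : U} {P : G.Walk u v} (hP : IsIPath G P)
    (huv : u ≠ v) (hnuv : ¬ G.Adj u v) (hxP : x ∉ P.support)
    (hxu : G.Adj x u) (hvx : G.Adj v x)
    (hx : ∀ y ∈ P.support, G.Adj x y → y = u ∨ y = v)
    (hzP : z ∉ P.support) (hzx : z ≠ x) :
    ∃ a b, G.Adj a b ∧ ∀ y, (y = x ∨ y ∈ P.support) → G.Adj z y → y = a ∨ y = b := by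
  have hlen : 2 ≤ P.length := by
    cases P with
    | nil => exact absurd rfl huv
    | cons h P =>
      cases P with
      | nil => exact absurd h hnuv
      | cons h' P => simp
  have hsup : ∀ y, y ∈ (Walk.cons hxu (P.concat hvx)).support ↔ (y = x ∨ y ∈ P.support) := by
    intro y
    rw [Walk.support_cons, Walk.support_concat]
    simp
    tauto
  have hadj : ∀ a b, (Walk.cons hxu (P.concat hvx)).toSubgraph.Adj a b ↔
      s(a,b) ∈ (Walk.cons hxu (P.concat hvx)).edges := by
    intro a b
    rw [← Walk.mem_edges_toSubgraph, Subgraph.mem_edgeSet]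
  have hole : IsHole G (Walk.cons hxu (P.concat hvx)) := by
    refine ⟨?_, ?_, ?_⟩
    · rw [Walk.cons_isCycle_iff]
      refine ⟨hP.1.concat hxP hvx, ?_⟩
      rw [Walk.edges_concat, List.concat_eq_append, List.mem_append]
      rintro (h | h)
      · exact hxP (Walk.fst_mem_support_of_mem_edges _ h)
      · simp at h
        grind
    · simp [Walk.length_concat]; omega
    · intro a ha b hb hab
      rw [Walk.mem_verts_toSubgraph, hsup] at ha hb
      rw [hadj, Walk.edges_cons, Walk.edges_concat, List.concat_eq_append]
      have hPadj : ∀ a b, P.toSubgraph.Adj a b → s(a,b) ∈ P.edges := by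
        intro a b h
        rwa [← Walk.mem_edges_toSubgraph, Subgraph.mem_edgeSet]
      simp only [List.mem_cons, List.mem_append, List.not_mem_nil, or_false, Sym2.eq_iff]
      rcases ha with ha | ha <;> rcases hb with hb | hb
      · subst ha; subst hb; exact absurd hab (G.loopless.irrefl _)
      · subst ha
        rcases hx b hb hab with e | e <;> simp [e]
      · subst hb
        rcases hx a ha hab.symm with e | e <;> simp [e]
      · right; left
        exact hPadj a b (hP.2 (by rwa [Walk.mem_verts_toSubgraph])
          (by rwa [Walk.mem_verts_toSubgraph]) hab)
  obtain ⟨a, b, hab, h⟩ := hs _ _ hole z (by rw [hsup]; tauto)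
  exact ⟨a, b, hab.adj_sub, fun y hy => h y ((hsup y).2 hy)⟩

theorem suffix_mem {u z : U} (P : G.Walk u z) (hP : IsIPath G P) {x : U} (hx : x ∈ P.support) :
    ∃ P' : G.Walk x z, IsIPath G P' ∧ ∀ y ∈ P'.support, y ∈ P.support := by
  induction P with
  | nil =>
    simp at hx; subst hx
    exact ⟨_, hP, fun y h => h⟩
  | cons h P ih =>
    rw [Walk.support_cons, List.mem_cons] at hx
    by_cases hxu : x ∈ P.support
    · obtain ⟨P', h1, h2⟩ := ih ((ipath_cons_iff _ _).1 hP).1 hxu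
      exact ⟨P', h1, fun y hy => by simp [h2 y hy]⟩
    · have : x = _ := hx.resolve_right hxu
      subst this
      exact ⟨_, hP, fun y h => h⟩

theorem suffix_nbr {u z : U} (P : G.Walk u z) (hP : IsIPath G P) {x : U}
    (hx : ∃ y ∈ P.support, G.Adj x y) :
    ∃ w, ∃ P' : G.Walk w z, IsIPath G P' ∧ (∀ y ∈ P'.support, y ∈ P.support) ∧
      G.Adj x w ∧ ∀ y ∈ P'.support, G.Adj x y → y = w := by
  induction P with
  | nil =>
    obtain ⟨y, hy, hxy⟩ := hx
    refine ⟨_, _, hP, fun y h => h, ?_, ?_⟩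
    · simp at hy; subst hy; exact hxy
    · intro y hy; simp at hy; simp [hy]
  | cons h P ih =>
    by_cases hxu : ∃ y ∈ P.support, G.Adj x y
    · obtain ⟨w, P', h1, h2, h3⟩ := ih ((ipath_cons_iff _ _).1 hP).1 hxu
      exact ⟨w, P', h1, fun y hy => by simp [h2 y hy], h3⟩
    · obtain ⟨y, hy, hxy⟩ := hx
      rw [Walk.support_cons, List.mem_cons] at hy
      have hy' := hy.resolve_right (fun h => hxu ⟨y, h, hxy⟩)
      subst hy'
      refine ⟨_, _, hP, fun y h => h, hxy, ?_⟩
      intro t ht hxt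
      rw [Walk.support_cons, List.mem_cons] at ht
      exact ht.resolve_right (fun h => hxu ⟨t, h, hxt⟩)

theorem ipath_first (R : U → Prop) {x y : U} (W : G.Walk x y) (hy : R y) :
    ∃ z, ∃ P : G.Walk x z, IsIPath G P ∧ (∀ t ∈ P.support, t ∈ W.support) ∧ R z ∧
      ∀ t ∈ P.support, R t → t = z := by
  induction W with
  | nil =>
    refine ⟨_, Walk.nil, ipath_nil _, fun t h => h, hy, ?_⟩
    intro t ht _; simpa using ht
  | @cons x x' y h W ih =>
    by_cases hx : R x
    · refine ⟨x, Walk.nil, ipath_nil _, ?_, hx, ?_⟩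
      · intro t ht; simp at ht; simp [ht]
      · intro t ht _; simpa using ht
    · obtain ⟨z, P, h1, h2, h3, h4⟩ := ih hy
      by_cases hxP : x ∈ P.support
      · obtain ⟨P', h5, h6⟩ := suffix_mem P h1 hxP
        exact ⟨z, P', h5, fun t ht => by simp [h2 t (h6 t ht)], h3, fun t ht => h4 t (h6 t ht)⟩
      · obtain ⟨w, P', h5, h6, h7, h8⟩ := suffix_nbr P h1 ⟨x', P.start_mem_support, h⟩
        refine ⟨z, Walk.cons h7 P', (ipath_cons_iff _ _).2 ⟨h5, fun hh => hxP (h6 _ hh), h8⟩,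
          ?_, h3, ?_⟩
        · intro t ht
          rw [Walk.support_cons, List.mem_cons] at ht
          rcases ht with rfl | ht
          · simp
          · simp [h2 t (h6 t ht)]
        · intro t ht hR
          rw [Walk.support_cons, List.mem_cons] at ht
          rcases ht with rfl | ht
          · exact absurd hR hx
          · exact h4 t (h6 t ht) hR

theorem walk_before (X : U → Prop) {x y : U} (W : G.Walk x y) (hx : ¬ X x) (hy : X y) :
    ∃ z, ∃ P : G.Walk x z, (∀ t ∈ P.support, t ∈ W.support ∧ ¬ X t) ∧ ∃ q, X q ∧ G.Adj z q := by
  induction W with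
  | nil => exact absurd hy hx
  | @cons x x' y h W ih =>
    by_cases hx' : X x'
    · refine ⟨x, Walk.nil, ?_, x', hx', h⟩
      intro t ht; simp at ht; subst ht; simp [hx]
    · obtain ⟨z, P, h1, h2⟩ := ih hx' hy
      refine ⟨z, Walk.cons h P, ?_, h2⟩
      intro t ht
      rw [Walk.support_cons, List.mem_cons] at ht
      rcases ht with rfl | ht
      · simp [hx]
      · simp [h1 t ht]

theorem ipath_split (R : U → Prop) {u v : U} (Q : G.Walk u v) (hQ : IsIPath G Q)
    (hR : ∃ y ∈ Q.support, R y) :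
    ∃ w, ∃ Q1 : G.Walk u w, ∃ Q2 : G.Walk w v, IsIPath G Q1 ∧ IsIPath G Q2 ∧
      (∀ y, y ∈ Q.support ↔ (y ∈ Q1.support ∨ y ∈ Q2.support)) ∧
      R w ∧ (∀ y ∈ Q1.support, R y → y = w) ∧
      ∀ p ∈ Q1.support, ∀ q ∈ Q2.support, p ≠ w → q ≠ w → p ≠ q ∧ ¬ G.Adj p q := by
  induction Q with
  | nil =>
    obtain ⟨y, hy, hR⟩ := hR
    refine ⟨_, Walk.nil, Walk.nil, ipath_nil _, ipath_nil _, by simp, ?_, by simp, by simp⟩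
    simp at hy; subst hy; exact hR
  | @cons u u' v h Q ih =>
    by_cases hu : R u
    · refine ⟨u, Walk.nil, Walk.cons h Q, ipath_nil _, hQ, by simp, hu, by simp, ?_⟩
      intro p hp q hq hpu; simp at hp; exact absurd hp hpu
    · have hc := (ipath_cons_iff _ _).1 hQ
      have hR' : ∃ y ∈ Q.support, R y := by
        obtain ⟨y, hy, hRy⟩ := hR
        rw [Walk.support_cons, List.mem_cons] at hy
        rcases hy with rfl | hy
        · exact absurd hRy hu
        · exact ⟨y, hy, hRy⟩
      obtain ⟨w, Q1, Q2, h1, h2, h3, h4, h5, h6⟩ := ih hc.1 hR'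
      refine ⟨w, Walk.cons h Q1, Q2, (ipath_cons_iff _ _).2 ⟨h1, ?_, ?_⟩, h2, ?_, h4, ?_, ?_⟩
      · exact fun hh => hc.2.1 ((h3 _).2 (Or.inl hh))
      · exact fun y hy => hc.2.2 y ((h3 _).2 (Or.inl hy))
      · intro y
        rw [Walk.support_cons, Walk.support_cons, List.mem_cons, List.mem_cons, h3]
        tauto
      · intro y hy hRy
        rw [Walk.support_cons, List.mem_cons] at hy
        rcases hy with rfl | hy
        · exact absurd hRy hu
        · exact h5 y hy hRy
      · intro p hp q hq hpw hqw
        rw [Walk.support_cons, List.mem_cons] at hp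
        rcases hp with rfl | hp
        · refine ⟨fun e => hc.2.1 (e ▸ (h3 q).2 (Or.inr hq)), fun hadj => ?_⟩
          have e := hc.2.2 q ((h3 q).2 (Or.inr hq)) hadj
          subst e
          exact (h6 q Q1.start_mem_support q hq hqw hqw).1 rfl
        · exact h6 p hp q hq hpw hqw

theorem ipath_join {u w z v : U} (Q : G.Walk u w) (T : G.Walk z v) (hQ : IsIPath G Q)
    (hT : IsIPath G T) (hwz : G.Adj w z)
    (hd : ∀ p ∈ Q.support, ∀ q ∈ T.support, p ≠ q ∧ (G.Adj p q → p = w ∧ q = z)) :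
    ∃ P : G.Walk u v, IsIPath G P ∧ ∀ y, y ∈ P.support ↔ (y ∈ Q.support ∨ y ∈ T.support) := by
  induction Q with
  | nil =>
    refine ⟨Walk.cons hwz T, (ipath_cons_iff _ _).2 ⟨hT, ?_, ?_⟩, by simp⟩
    · intro h; exact (hd _ (by simp) _ h).1 rfl
    · intro y hy h; exact ((hd _ (by simp) y hy).2 h).2
  | @cons u u' w h Q ih =>
    have hc := (ipath_cons_iff _ _).1 hQ
    obtain ⟨P, h1, h2⟩ := ih hc.1 hwz (fun p hp => hd p (by simp [hp]))
    refine ⟨Walk.cons h P, (ipath_cons_iff _ _).2 ⟨h1, ?_, ?_⟩, ?_⟩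
    · rw [h2]
      rintro (hh | hh)
      · exact hc.2.1 hh
      · exact (hd u (by simp) u hh).1 rfl
    · intro y hy hadj
      rcases (h2 y).1 hy with hh | hh
      · exact hc.2.2 y hh hadj
      · have := ((hd u (by simp) y hh).2 hadj).1
        subst this
        exact absurd Q.end_mem_support hc.2.1
    · intro y
      rw [Walk.support_cons, Walk.support_cons, List.mem_cons, List.mem_cons, h2]
      tauto

theorem no_cut (hG : ¬ HasStarCutset G) {b : U} {C : Set U} (hb : b ∈ C)
    (hC : C ⊆ closedNbhd G b) {x y : U} (hx : x ∉ C) (hy : y ∉ C) :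
    ∃ W : G.Walk x y, ∀ t ∈ W.support, t ∉ C := by
  by_contra hcon
  apply hG
  refine ⟨{z | ∃ W : G.Walk x z, ∀ t ∈ W.support, t ∉ C}, C,
    {z | z ∉ C ∧ ¬ ∃ W : G.Walk x z, ∀ t ∈ W.support, t ∉ C}, ⟨?_, ?_, ?_, ?_, ?_⟩, ?_, ?_,
    b, hb, hC⟩
  · ext z
    simp only [Set.mem_union, Set.mem_ofPred_eq, Set.mem_univ, iff_true]
    tauto
  · rw [Set.disjoint_left]
    rintro z ⟨W, hW⟩
    exact hW z W.end_mem_support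
  · rw [Set.disjoint_left]
    rintro z h1 h2
    exact h2.2 h1
  · rw [Set.disjoint_left]
    rintro z h1 h2
    exact h2.1 h1
  · rintro p ⟨W, hW⟩ q ⟨hq, hq'⟩ hpq
    apply hq'
    refine ⟨W.concat hpq, ?_⟩
    intro t ht
    rw [Walk.support_concat] at ht
    simp at ht
    rcases ht with ht | rfl
    · exact hW t ht
    · exact hq
  · exact ⟨x, Walk.nil, by simpa using hx⟩
  · exact ⟨y, hy, hcon⟩

/-- No star cutset: vertices x, y outside N[b] or removed from it are joined by an induced path
whose interior avoids N[b]. -/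
theorem walk_avoid (hG : ¬ HasStarCutset G) (b x y : U) (hx : x ≠ b) (hy : y ≠ b) :
    ∃ W : G.Walk x y, ∀ t ∈ W.support, t ≠ b ∧ (G.Adj b t → t = x ∨ t = y) := by
  obtain ⟨W, hW⟩ := no_cut hG (b := b) (C := closedNbhd G b \ {x, y}) (x := x) (y := y)
    (by simp [closedNbhd, hx.symm, hy.symm]) Set.sdiff_subset (by simp) (by simp)
  refine ⟨W, fun t ht => ?_⟩
  have := hW t ht
  simp [closedNbhd] at this
  constructor
  · rintro rfl; have := this (Or.inl rfl); grind
  · intro h; have := this (Or.inr h); grind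

theorem ipath_avoid (hG : ¬ HasStarCutset G) (b x y : U) (hx : x ≠ b) (hy : y ≠ b) :
    ∃ P : G.Walk x y, IsIPath G P ∧
      ∀ t ∈ P.support, t ≠ b ∧ (G.Adj b t → t = x ∨ t = y) := by
  obtain ⟨W, hW⟩ := walk_avoid hG b x y hx hy
  obtain ⟨z, P, h1, h2, h3, -⟩ := ipath_first (fun t => t = y) W rfl
  subst h3
  exact ⟨P, h1, fun t ht => hW t (h2 t ht)⟩

theorem no_diamond (hs : Sparse G) (hG : ¬ HasStarCutset G) {a b c d : U}
    (hab : G.Adj a b) (hac : G.Adj a c) (had : G.Adj a d) (hbc : G.Adj b c) (hbd : G.Adj b d)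
    (hcd : c ≠ d) : G.Adj c d := by
  by_contra hn
  obtain ⟨P, h1, h2⟩ := ipath_avoid hG a c d hac.ne' had.ne'
  obtain ⟨s, t, -, h⟩ := sparse_use hs (x := a) (z := b) h1 hcd hn
    (fun h => (h2 a h).1 rfl) hac had.symm (fun y hy => (h2 y hy).2)
    (fun h => by rcases (h2 b h).2 hab with e | e
                 · exact hbc.ne e
                 · exact hbd.ne e) hab.ne'
  have e1 := h a (Or.inl rfl) hab.symm
  have e2 := h c (Or.inr P.start_mem_support) hbc
  have e3 := h d (Or.inr P.end_mem_support) hbd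
  have := hac.ne
  have := had.ne
  grind

theorem main_contra (hG : VerySparse G) (hN : ¬ HasStarCutset G) {a b c p : U}
    (hab : G.Adj a b) (hbc : G.Adj b c) (hac : G.Adj a c) (hbp : G.Adj b p)
    (hpa : p ≠ a) (hpna : ¬ G.Adj p a) : False := by
  obtain ⟨hs, hpyr, hprism⟩ := hG
  have hpc : p ≠ c := by rintro rfl; exact hpna hac.symm
  have hpnc : ¬ G.Adj p c := by
    intro h
    exact hpna (no_diamond hs hN hbc hbp hab.symm h.symm hac.symm hpa)
  obtain ⟨Q, hQ, hQb⟩ := ipath_avoid hN b p a hbp.ne' hab.ne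
  have hbQ : b ∉ Q.support := fun h => (hQb b h).1 rfl
  have hcQ : c ∉ Q.support := fun h => by
    rcases (hQb c h).2 hbc with e | e
    · exact hpc e.symm
    · exact hac.ne e.symm
  have hcQn : ∀ q ∈ Q.support, q ≠ a → ¬ G.Adj c q := by
    intro q hq hqa hcq
    obtain ⟨s, t, -, h⟩ := sparse_use hs (x := b) (z := c) hQ hpa hpna hbQ hbp hab
      (fun y hy => (hQb y hy).2) hcQ hbc.ne'
    have e1 := h b (Or.inl rfl) hbc.symm
    have e2 := h a (Or.inr Q.end_mem_support) hac.symm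
    have e3 := h q (Or.inr hq) hcq
    have := hab.ne
    have : q ≠ b := fun e => hbQ (e ▸ hq)
    grind
  obtain ⟨W, hW⟩ := walk_avoid hN b c p hbc.ne' hbp.ne'
  obtain ⟨s', S', hS', q', hq', hsq'⟩ := walk_before (fun t => t ∈ Q.support ∧ t ≠ a) W
    (fun h => hcQ h.1) ⟨Q.start_mem_support, hpa⟩
  obtain ⟨s, S, hS, hSS, ⟨q, ⟨hqQ, hqa⟩, hsq⟩, hSR⟩ :=
    ipath_first (fun t => ∃ q, (q ∈ Q.support ∧ q ≠ a) ∧ G.Adj t q) S' ⟨q', hq', hsq'⟩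
  have hSQ' : ∀ t ∈ S.support, t ∈ Q.support → t = a := by
    intro t ht htQ
    by_contra hta
    exact (hS' t (hSS t ht)).2 ⟨htQ, hta⟩
  have hSb : ∀ t ∈ S.support, t ≠ b ∧ (G.Adj b t → t = c) := by
    intro t ht
    have h1 := hS' t (hSS t ht)
    have h2 := hW t h1.1
    refine ⟨h2.1, fun h => ?_⟩
    rcases h2.2 h with e | e
    · exact e
    · exact absurd ⟨e ▸ Q.start_mem_support, e ▸ hpa⟩ h1.2
  have haS : a ∉ S.support := fun h => hac.ne ((hSb a h).2 hab.symm)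
  have hbS : b ∉ S.support := fun h => (hSb b h).1 rfl
  have hSQ : ∀ t ∈ S.support, t ∉ Q.support := fun t ht htQ =>
    haS ((hSQ' t ht htQ) ▸ ht)
  have hSR' : ∀ t ∈ S.support, ∀ q ∈ Q.support, q ≠ a → G.Adj t q → t = s :=
    fun t ht q hq hqa h => hSR t ht ⟨q, ⟨hq, hqa⟩, h⟩
  have hsc : s ≠ c := by rintro rfl; exact hcQn q hqQ hqa hsq
  obtain ⟨w, Q1, Q2, hQ1, hQ2, hQQ, ⟨hwa, hsw⟩, hQ1R, hQd⟩ :=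
    ipath_split (fun t => t ≠ a ∧ G.Adj s t) Q hQ ⟨q, hqQ, hqa, hsq⟩
  have haQ1 : a ∉ Q1.support := fun h =>
    (hQd a h a Q2.end_mem_support hwa.symm hwa.symm).1 rfl
  have hQ1Q : ∀ t ∈ Q1.support, t ∈ Q.support := fun t ht => (hQQ t).2 (Or.inl ht)
  have hQ2Q : ∀ t ∈ Q2.support, t ∈ Q.support := fun t ht => (hQQ t).2 (Or.inr ht)
  have hsS : s ∈ S.support := S.end_mem_support
  have hwQ : w ∈ Q.support := hQ1Q w Q1.end_mem_support
  have hQ1S : ∀ x ∈ Q1.support, ∀ t ∈ S.support, x ≠ t ∧ (G.Adj x t → x = w ∧ t = s) := by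
    intro x hx t ht
    have hxa : x ≠ a := fun e => haQ1 (e ▸ hx)
    refine ⟨fun e => hSQ t ht (e ▸ hQ1Q x hx), fun h => ?_⟩
    have e := hSR' t ht x (hQ1Q x hx) hxa h.symm
    subst e
    exact ⟨hQ1R x hx ⟨hxa, h.symm⟩, rfl⟩
  -- `a` has no neighbours in `S` except `c`
  have haS' : ∀ t ∈ S.support, G.Adj a t → t = c := by
    intro t ht hat
    by_contra htc
    obtain ⟨P, hP, hPs⟩ := ipath_join Q1 S.reverse hQ1 (ipath_reverse hS) hsw.symm
      (fun x hx t ht => hQ1S x hx t (by simpa using ht))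
    have hPs' : ∀ y, y ∈ P.support ↔ (y ∈ Q1.support ∨ y ∈ S.support) := by
      intro y; rw [hPs]; simp
    obtain ⟨s1, t1, -, h⟩ := sparse_use hs (x := b) (z := a) hP hpc hpnc
      (by rw [hPs']; rintro (h | h)
          · exact hbQ (hQ1Q b h)
          · exact hbS h) hbp hbc.symm
      (by
        intro y hy hby
        rcases (hPs' y).1 hy with h | h
        · rcases (hQb y (hQ1Q y h)).2 hby with e | e
          · exact Or.inl e
          · exact absurd (e ▸ h) haQ1
        · exact Or.inr ((hSb y h).2 hby))
      (by rw [hPs']; tauto) hab.ne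
    have e1 := h b (Or.inl rfl) hab
    have e2 := h c (Or.inr P.end_mem_support) hac
    have e3 := h t (Or.inr ((hPs' t).2 (Or.inr ht))) hat
    have := hbc.ne
    have := (hSb t ht).1
    grind
  have hQ2S : ∀ x ∈ Q2.support, ∀ t ∈ S.support, x ≠ t ∧ 
      (G.Adj x t → (x = a ∧ t = c) ∨ t = s) := by
    intro x hx t ht
    refine ⟨fun e => hSQ t ht (e ▸ hQ2Q x hx), fun h => ?_⟩
    by_cases hxa : x = a
    · subst hxa; exact Or.inl ⟨rfl, haS' t ht h⟩
    · exact Or.inr (hSR' t ht x (hQ2Q x hx) hxa h.symm)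
  have hsa : ¬ G.Adj s a := fun h => hsc (haS' s hsS h.symm)
  have hbQ1 : ∀ y ∈ Q1.support, G.Adj b y → y = p := by
    intro y hy h
    rcases (hQb y (hQ1Q y hy)).2 h with e | e
    · exact e
    · exact absurd (e ▸ hy) haQ1
  have hB : IsIPath G (Walk.cons hbp Q1) :=
    (ipath_cons_iff _ _).2 ⟨hQ1, fun h => hbQ (hQ1Q b h), hbQ1⟩
  have hBQ2 : ∀ x ∈ (Walk.cons hbp Q1).support, x ≠ w → ∀ y ∈ Q2.support, y ≠ w →
      x ≠ y ∧ (G.Adj x y → x = b ∧ y = a) := by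
    intro x hx hxw y hy hyw
    rw [Walk.support_cons, List.mem_cons] at hx
    rcases hx with rfl | hx
    · refine ⟨fun e => hbQ (e ▸ hQ2Q y hy), fun h => ⟨rfl, ?_⟩⟩
      rcases (hQb y (hQ2Q y hy)).2 h with e | e
      · subst e
        exact absurd rfl (hQd y Q1.start_mem_support y hy hyw hyw).1
      · exact e
    · have := hQd x hx y hy hxw hyw
      exact ⟨this.1, fun h => absurd h this.2⟩
  have hBS : ∀ x ∈ (Walk.cons hbp Q1).support, ∀ t ∈ S.support, 
      x ≠ t ∧ (G.Adj x t → (x = b ∧ t = c) ∨ (x = w ∧ t = s)) := by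
    intro x hx t ht
    rw [Walk.support_cons, List.mem_cons] at hx
    rcases hx with rfl | hx
    · exact ⟨fun e => hbS (e ▸ ht), fun h => Or.inl ⟨rfl, (hSb t ht).2 h⟩⟩
    · exact ⟨(hQ1S x hx t ht).1, fun h => Or.inr ((hQ1S x hx t ht).2 h)⟩
  have hSlen : 1 ≤ S.length := by
    rcases Nat.eq_zero_or_pos S.length with h | h
    · exact absurd (Walk.eq_of_length_eq_zero h).symm hsc
    · exact h
  have hQ2len : 1 ≤ Q2.length := by
    rcases Nat.eq_zero_or_pos Q2.length with h | h
    · exact absurd (Walk.eq_of_length_eq_zero h) hwa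
    · exact h
  by_cases hone : ∀ y ∈ Q2.support, G.Adj s y → y = w
  · -- pyramid
    apply hpyr
    have hwS : w ∉ S.support := fun h => hSQ w h hwQ
    refine ⟨w, b, a, c, (Walk.cons hbp Q1).reverse, Q2, Walk.cons hsw.symm S.reverse,
      hab.symm, hac, hbc, ipath_reverse hB, hQ2, ?_, ?_, hQ2len, ?_, ?_, ?_, ?_, ?_, ?_, ?_⟩
    · refine (ipath_cons_iff _ _).2 ⟨ipath_reverse hS, by simpa using hwS, ?_⟩
      intro y hy h
      exact hSR' y (by simpa using hy) w hwQ hwa h.symm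
    · simp
    · simp
    · rintro ⟨h1, h2⟩
      have e1 : Q1.length = 0 := by simpa using h1
      have e2 := Walk.eq_of_length_eq_zero e1
      have e3 := Walk.adj_of_length_eq_one h2
      exact hpna (e2 ▸ e3)
    · rintro ⟨h1, h2⟩
      rw [Walk.length_cons, Walk.length_reverse] at h2; omega
    · rintro ⟨h1, h2⟩
      rw [Walk.length_cons, Walk.length_reverse] at h2; omega
    · intro x hx hxw y hy hyw
      exact hBQ2 x (by rw [Walk.support_reverse] at hx; exact List.mem_reverse.1 hx) hxw y hy hyw
    · intro x hx hxw y hy hyw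
      rw [Walk.support_cons, List.mem_cons] at hy
      have hy' : y ∈ S.support := by simpa using hy.resolve_left hyw
      have := hBS x (by rw [Walk.support_reverse] at hx; exact List.mem_reverse.1 hx) y hy'
      exact ⟨this.1, fun h => (this.2 h).resolve_right (fun h => hxw h.1)⟩
    · intro x hx hxw y hy hyw
      rw [Walk.support_cons, List.mem_cons] at hy
      have hy' : y ∈ S.support := by simpa using hy.resolve_left hyw
      have := hQ2S x hx y hy'
      refine ⟨this.1, fun h => (this.2 h).resolve_right (fun e => ?_)⟩
      subst e
      exact hxw (hone x hx h.symm)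
  · -- prism
    push Not at hone
    obtain ⟨w'', hw''Q, hsw'', hw''w⟩ := hone
    have hsQ : s ∉ Q.support := hSQ s hsS
    obtain ⟨s1, t1, hst, h⟩ := sparse_use hs (x := b) (z := s) hQ hpa hpna hbQ hbp hab
      (fun y hy => (hQb y hy).2) hsQ (hSb s hsS).1
    have hmem : ∀ y ∈ Q.support, G.Adj s y → y = w ∨ y = w'' := by
      intro y hy hsy
      have e1 := h w (Or.inr hwQ) hsw
      have e2 := h w'' (Or.inr (hQ2Q _ hw''Q)) hsw''
      have e3 := h y (Or.inr hy) hsy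
      grind
    have hww'' : G.Adj w w'' := by
      have e1 := h w (Or.inr hwQ) hsw
      have e2 := h w'' (Or.inr (hQ2Q _ hw''Q)) hsw''
      have := hst.symm
      grind
    clear h hst
    cases Q2 with
    | nil => exact hwa rfl
    | @cons _ w' _ hww' Q3 =>
      have hc := (ipath_cons_iff _ _).1 hQ2
      have hw''3 : w'' ∈ Q3.support := by
        rw [Walk.support_cons, List.mem_cons] at hw''Q
        exact hw''Q.resolve_left hw''w
      have e := hc.2.2 w'' hw''3 hww''
      subst e
      have hQ32 : ∀ x ∈ Q3.support, x ∈ (Walk.cons hww' Q3).support := by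
        intro x hx; simp [hx]
      apply hprism
      refine ⟨b, a, c, w, w'', s, Walk.cons hbp Q1, Q3.reverse, S,
        hab.symm, hac, hbc, hww', hsw''.symm, hsw.symm, hB, ipath_reverse hc.1, hS, 
        by simp, ?_, hSlen, ?_, ?_, ?_⟩
      · rw [Walk.length_reverse]
        rcases Nat.eq_zero_or_pos Q3.length with h | h
        · exact absurd ((Walk.eq_of_length_eq_zero h) ▸ hsw'') hsa
        · exact h
      · intro x hx y hy
        have hy : y ∈ Q3.support := by simpa using hy
        have hyw : y ≠ w := fun e => hc.2.1 (e ▸ hy)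
        by_cases hxw : x = w
        · subst hxw
          exact ⟨hyw.symm, fun h => Or.inr ⟨rfl, hc.2.2 y hy h⟩⟩
        · have := hBQ2 x hx hxw y (hQ32 y hy) hyw
          exact ⟨this.1, fun h => Or.inl (this.2 h)⟩
      · intro x hx t ht
        exact hBS x hx t ht
      · intro x hx t ht
        have hx : x ∈ Q3.support := by simpa using hx
        have := hQ2S x (hQ32 x hx) t ht
        refine ⟨this.1, fun h => ?_⟩
        rcases this.2 h with e | e
        · exact Or.inl e
        · subst e
          rcases hmem x (hQ2Q x (hQ32 x hx)) h.symm with e | e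
          · exact absurd (e ▸ hx) hc.2.1
          · exact Or.inr ⟨e, rfl⟩

end Helpers

/-- Lemma `cliqueortrianglefree`: a very sparse graph is triangle-free,
complete, or admits a star cutset. -/
theorem statement8 {V : Type} [Fintype V] (G : SimpleGraph V) (hG : VerySparse G) :
    (¬∃ a b c : V, G.Adj a b ∧ G.Adj b c ∧ G.Adj a c) ∨
    (∀ u v : V, u ≠ v → G.Adj u v) ∨
    HasStarCutset G := by
  by_contra hcon
  push Not at hcon
  obtain ⟨⟨a, b, c, hab, hbc, hac⟩, ⟨u, v, huv, hnuv⟩, hN⟩ := hcon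
  by_cases hall : ∀ x, x ≠ b → G.Adj b x
  · have hub : u ≠ b := by rintro rfl; exact hnuv (hall v huv.symm)
    have hvb : v ≠ b := by rintro rfl; exact hnuv (hall u huv).symm
    obtain ⟨W, hW⟩ := walk_avoid hN b u v hub hvb
    cases W with
    | nil => exact huv rfl
    | @cons _ t _ h W =>
      have ht := hW t (by simp)
      rcases ht.2 (hall t ht.1) with e | e
      · exact h.ne e.symm
      · exact hnuv (e ▸ h)
  · push Not at hall
    obtain ⟨x, hxb, hbx⟩ := hall
    obtain ⟨W, hW⟩ := walk_avoid hN b a x hab.ne hxb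
    cases W with
    | nil => exact hbx hab.symm
    | @cons _ t _ h W =>
      have ht := hW t (by simp)
      have hbt : ¬ G.Adj b t := by
        intro hbt
        rcases ht.2 hbt with e | e
        · exact h.ne e.symm
        · exact hbx (e ▸ hbt)
      exact main_contra hG hN (a := b) (b := a) (c := c) (p := t) hab.symm hac hbc h ht.1
        (fun h => hbt h.symm)

end Paper
end

section
/- Let K be an integer, let (G,w) be a 2K-unbalanced pair, and let K_1, K_2 be cliques of size at most K in G. If S(K_1,K_2) is active, then every vertex of K_1 ∪ K_2 has a neighbor in B(K_1,K_2). -/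
open SimpleGraph Set List

namespace Paper

theorem aux_conn_insert {V : Type} (G : SimpleGraph V) (D : Set V) (v d : V)
    (hD : (G.induce D).Connected) (hd : d ∈ D) (h : G.Adj d v) :
    (G.induce (D ∪ {d, v})).Connected :=
  induce_union_connected hD.preconnected (induce_pair_connected_of_adj h).preconnected
    ⟨d, hd, by simp⟩

theorem aux_start {V : Type} (G : SimpleGraph V) (x y a b : V) (P : G.Walk x y)
    (hP : IsIPath G P) (ha : a ∈ P.support) (hb : b ∈ P.support)
    (hxa : G.Adj x a) (hxb : G.Adj x b) : a = b := by
  obtain ⟨hp, hi⟩ := hP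
  have key : ∀ c, c ∈ P.support → G.Adj x c → P.toSubgraph.Adj x c := by
    intro c hc hxc
    exact hi (by simp [Walk.mem_verts_toSubgraph]) (by simpa [Walk.mem_verts_toSubgraph] using hc) hxc
  have h1 := key a ha hxa
  have h2 := key b hb hxb
  clear key hi
  cases P with
  | nil =>
    simp at ha
    subst ha
    exact absurd hxa (G.irrefl)
  | cons h q =>
    rename_i u
    have hx : x ∉ q.support := ((Walk.cons_isPath_iff h q).1 hp).2
    have key : ∀ c, (Walk.cons h q).toSubgraph.Adj x c → c = u := by
      intro c hc
      rw [Walk.toSubgraph, Subgraph.sup_adj] at hc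
      rcases hc with hc | hc
      · simp only [subgraphOfAdj_adj, Sym2.eq_iff] at hc
        rcases hc with hc | hc
        · exact hc.2.symm
        · exact absurd h (by rw [hc.2]; exact G.irrefl)
      · exact absurd ((Walk.mem_verts_toSubgraph q).1 hc.fst_mem) hx
    rw [key a h1, key b h2]

/-- Lemma `active`. -/
theorem statement12 {V : Type} [Fintype V] (G : SimpleGraph V) (w : V → ℝ) (K : ℕ)
    (hunb : Unbalanced G w (2 * K))
    (K₁ K₂ : Set V) (hK₁ : G.IsClique K₁) (hK₂ : G.IsClique K₂)
    (hc₁ : K₁.ncard ≤ K) (hc₂ : K₂.ncard ≤ K)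
    (B : Set V) (hact : ActivePair G w K K₁ K₂ B) :
    ∀ v ∈ K₁ ∪ K₂, ∃ b ∈ B, G.Adj v b := by
  intro v hv
  by_contra hno
  push Not at hno
  obtain ⟨⟨⟨hB, hwB⟩, ⟨D, hD, hDsub, hDN⟩, -⟩, hmin⟩ := hact
  obtain ⟨hBne, hBX, hBc, hBmax⟩ := hB
  obtain ⟨hDne, hDX, hDc, hDmax⟩ := hD
  have hU : (K₁ \ {v}) ∪ (K₂ \ {v}) = (K₁ ∪ K₂) \ {v} := Set.union_diff_distrib.symm
  have hvB : v ∉ B := fun h => hBX h hv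
  have hvD : v ∉ D := fun h => hDX h hv
  have hDB : ∀ d ∈ D, d ∉ B := fun d hd hb => hDsub hd (Or.inl (Or.inl hb))
  -- `B` is still a component
  have hB' : IsComponentOf G ((K₁ \ {v}) ∪ (K₂ \ {v})) B := by
    rw [hU]
    refine ⟨hBne, fun b hb h => hBX hb h.1, hBc, ?_⟩
    intro D' hsub hD'X hD'c
    by_contra hne
    obtain ⟨z, hzD, hzB⟩ : ∃ z ∈ D', z ∉ B := by
      by_contra hcon
      push Not at hcon
      exact hne (Set.Subset.antisymm hcon hsub)
    obtain ⟨b, hb⟩ := hBne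
    obtain ⟨p⟩ := hD'c.preconnected ⟨b, hsub hb⟩ ⟨z, hzD⟩
    obtain ⟨e, -, he1, he2⟩ := p.exists_boundary_dart (Subtype.val ⁻¹' B) hb hzB
    have hadj : G.Adj e.fst.1 e.snd.1 := e.adj
    have hcon := aux_conn_insert G B e.snd.1 e.fst.1 hBc he1 hadj
    have hsv : e.snd.1 ≠ v := by
      intro h
      rw [h] at hadj
      exact hno _ he1 hadj.symm
    have heq := hBmax _ Set.subset_union_left (by
      rintro t (ht | ht | ht)
      · exact hBX ht
      · rw [ht]; exact hBX he1
      · rw [ht]; exact fun h => hD'X e.snd.2 ⟨h, hsv⟩) hcon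
    apply he2
    change e.snd.1 ∈ B
    rw [← heq]
    right; right; rfl
  obtain ⟨-, d, hd, hvd⟩ := hDN hv
  have hconn := aux_conn_insert G D v d hDc hd hvd.symm
  obtain ⟨E, hEle, hEmax⟩ := (Set.toFinite
    {E : Set V | E ⊆ ((K₁ ∪ K₂) \ {v})ᶜ ∧ (G.induce E).Connected}).exists_le_maximal
    (a := D ∪ {d, v}) ⟨by
      rintro t (ht | ht | ht)
      · exact fun h => hDX ht h.1
      · rw [ht]; exact fun h => hDX hd h.1
      · exact fun h => h.2 ht, hconn⟩
  have hDE : D ⊆ E := Set.subset_union_left.trans hEle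
  have hvE : v ∈ E := hEle (by right; right; rfl)
  have hEX := hEmax.prop.1
  have hEc := hEmax.prop.2
  have hEB : ∀ t ∈ E, t ∉ B := by
    intro t ht htB
    have h1 := induce_union_connected hBc.preconnected hEc.preconnected ⟨t, htB, ht⟩
    have h2 := hB'.2.2.2 _ Set.subset_union_left (by
      rw [hU]
      exact Set.union_subset (fun b hb h => hBX hb h.1) hEX) h1
    apply hvB
    rw [← h2]
    exact Or.inr hvE
  have hNd : ∀ z ∈ K₁ ∪ K₂, ∃ a ∈ D, G.Adj z a := fun z hz => (hDN hz).2
  have hprop : ProperPair G w (K₁ \ {v}) (K₂ \ {v}) B := by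
    refine ⟨⟨hB', hwB⟩, ⟨E, ?_, ?_, ?_⟩, ?_⟩
    · rw [hU]
      exact ⟨⟨v, hvE⟩, hEX, hEc, fun D' h1 h2 h3 =>
        Set.Subset.antisymm (hEmax.2 ⟨h2, h3⟩ h1) h1⟩
    · intro t ht h
      rw [Set.union_assoc, hU] at h
      rcases h with h | h
      · exact hEB t ht h
      · exact hEX ht h
    · rw [hU]
      intro z hz
      obtain ⟨a, ha, hza⟩ := hNd z hz.1
      exact ⟨fun h => hEX h hz, a, hDE ha, hza⟩
    · rintro - - ⟨x, y, P, hx, hy, hP, hsup⟩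
      have hxm : x ∈ K₁ \ {v} := by rw [hx]; rfl
      have hym : y ∈ K₂ \ {v} := by rw [hy]; rfl
      have hmem : ∀ t ∈ E, t ∈ P.support := by
        intro t ht
        have : t ∈ {v | v ∈ P.support} := by
          rw [hsup]
          left; left
          intro h
          rw [Set.union_assoc, hU] at h
          rcases h with h | h
          · exact hEB t ht h
          · exact hEX ht h
        exact this
      rcases hv with hv | hv
      · obtain ⟨a, ha, hxa⟩ := hNd x (Or.inl hxm.1)
        have := aux_start G x y v a P hP (hmem v hvE) (hmem a (hDE ha))
          (hK₁ hxm.1 hv hxm.2) hxa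
        exact hvD (this ▸ ha)
      · obtain ⟨a, ha, hya⟩ := hNd y (Or.inr hym.1)
        have := aux_start G y x v a P.reverse
          ⟨hP.1.reverse, by rw [Walk.toSubgraph_reverse]; exact hP.2⟩
          (by simpa using hmem v hvE) (by simpa using hmem a (hDE ha))
          (hK₂ hym.1 hv hym.2) hya
        exact hvD (this ▸ ha)
  refine (hmin (K₁ \ {v}) (K₂ \ {v}) B (hK₁.subset Set.diff_subset) (hK₂.subset Set.diff_subset)
    ((Set.ncard_le_ncard Set.diff_subset (Set.toFinite _)).trans hc₁)
    ((Set.ncard_le_ncard Set.diff_subset (Set.toFinite _)).trans hc₂) hprop ?_).1 ?_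
  · rw [hU]
    intro h
    rw [h] at hv
    exact hv.2 rfl
  · rw [Set.union_assoc, Set.union_assoc, hU]
    refine ⟨Set.union_subset_union_right _ Set.diff_subset, fun h => ?_⟩
    rcases h (Or.inr hv) with h | h
    · exact hvB h
    · exact h.2 rfl

end Paper
end
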